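/- There exists an absolute constant C > 0 with the following property: for all integers n, a, m, x, y with a ≠ 0, m ≥ 1 and 0 < |F_{n,a}(x, y)| ≤ m, one has log max{|x|, |y|} ≤ C·μ, where μ = (log m + |a|·log|n|)·(log|n|)^2·log log|n| if |n| ≥ 3, and μ = log m + |a| if n ∈ {0, 1, −1, 2, −2}. -/

import Mathlib

noncomputable section

/-- The polynomial `f_n(X) = X³ − (n−1)X² − (n+2)X − 1`. -/
def fn (n : ℤ) (X : ℝ) : ℝ := X ^ 3 - ((n : ℝ) - 1) * X ^ 2 - ((n : ℝ) + 2) * X - 1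

/-- `l0, l1, l2` are the three distinct real roots of `f_n`. -/
def IsRoots (n : ℤ) (l0 l1 l2 : ℝ) : Prop :=
  fn n l0 = 0 ∧ fn n l1 = 0 ∧ fn n l2 = 0 ∧ l0 ≠ l1 ∧ l0 ≠ l2 ∧ l1 ≠ l2

/-- The form `F_{n,a}(x,y) = ∏ (x − λᵃ y)` over the three roots `λ` of `f_n`. -/
def Fna (a : ℤ) (l0 l1 l2 x y : ℝ) : ℝ :=
  (x - l0 ^ a * y) * (x - l1 ^ a * y) * (x - l2 ^ a * y)

section Polynomials

open Polynomial

lemma abs_eval_hasseDeriv_le_of_pow_le {P : ℝ[X]} {D t i : ℕ} {H E x : ℝ}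
    (hdeg : P.natDegree ≤ D) (hH : ∀ j, |P.coeff j| ≤ H) (ht : ∀ j < t, P.coeff j = 0)
    (hE : 0 ≤ E) (hx : ∀ j ≤ D, t ≤ j + i → |x| ^ j ≤ E) :
    |(hasseDeriv i P).eval x| ≤ 4 ^ D * H * E := by
  have hH0 : 0 ≤ H := (abs_nonneg _).trans (hH 0)
  have hlt : (hasseDeriv i P).natDegree < D + 1 :=
    Nat.lt_succ_of_le ((natDegree_hasseDeriv_le P i).trans ((Nat.sub_le _ _).trans hdeg))
  rw [eval_eq_sum_range' hlt]
  have hterm : ∀ j ∈ Finset.range (D + 1),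
      |(hasseDeriv i P).coeff j * x ^ j| ≤ 2 ^ D * H * E := by
    intro j hj
    have hjD : j ≤ D := Nat.lt_succ_iff.mp (Finset.mem_range.mp hj)
    rw [hasseDeriv_coeff, abs_mul, abs_mul, abs_pow]
    by_cases h1 : D < j + i
    · rw [coeff_eq_zero_of_natDegree_lt (hdeg.trans_lt h1)]
      simpa using by positivity
    by_cases h2 : j + i < t
    · rw [ht _ h2]
      simpa using by positivity
    have hc : |(((j + i).choose i : ℕ) : ℝ)| ≤ 2 ^ D := by
      rw [abs_of_nonneg (by positivity)]
      calc (((j + i).choose i : ℕ) : ℝ) ≤ ((2 ^ (j + i) : ℕ) : ℝ) := by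
            exact_mod_cast Nat.choose_le_two_pow _ _
        _ ≤ 2 ^ D := by
            push_cast
            exact pow_le_pow_right₀ (by norm_num) (not_lt.mp h1)
    exact mul_le_mul (mul_le_mul hc (hH _) (abs_nonneg _) (by positivity))
      (hx j hjD (not_lt.mp h2)) (by positivity) (by positivity)
  calc _ ≤ ∑ j ∈ Finset.range (D + 1), |(hasseDeriv i P).coeff j * x ^ j| :=
        Finset.abs_sum_le_sum_abs _ _
    _ ≤ ∑ _j ∈ Finset.range (D + 1), 2 ^ D * H * E := Finset.sum_le_sum hterm
    _ = ((D : ℝ) + 1) * (2 ^ D * H * E) := by simp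
    _ ≤ 2 ^ D * (2 ^ D * H * E) := by
        gcongr
        exact_mod_cast Nat.succ_le_of_lt D.lt_two_pow_self
    _ = 4 ^ D * H * E := by
        rw [show (4 : ℝ) = 2 * 2 by norm_num, mul_pow]
        ring

lemma abs_eval_hasseDeriv_le {P : ℝ[X]} {D : ℕ} {H x r : ℝ}
    (hdeg : P.natDegree ≤ D) (hH : ∀ j, |P.coeff j| ≤ H) (hx : |x| ≤ r) (hr : 1 ≤ r) (i : ℕ) :
    |(hasseDeriv i P).eval x| ≤ 4 ^ D * H * r ^ D :=
  abs_eval_hasseDeriv_le_of_pow_le (t := 0) hdeg hH (by simp) (by positivity) fun _ hj _ =>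
    (pow_le_pow_left₀ (abs_nonneg _) hx _).trans (pow_le_pow_right₀ hr hj)

lemma eval_hasseDeriv_eq_taylor (P : ℝ[X]) (i : ℕ) (x y : ℝ) :
    (hasseDeriv i P).eval x = (hasseDeriv i (taylor y P)).eval (x - y) := by
  rw [← taylor_coeff, ← taylor_coeff, taylor_taylor, sub_add_cancel]

/-- A polynomial vanishing to order `t` at `y` is small, with its derivatives, near `y`. -/
lemma abs_eval_hasseDeriv_le_of_vanish {P : ℝ[X]} {D t : ℕ} {G x y δ : ℝ}
    (hdeg : P.natDegree ≤ D) (hG : ∀ l, |(hasseDeriv l P).eval y| ≤ G)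
    (ht : ∀ l < t, (hasseDeriv l P).eval y = 0) (hx : |x - y| ≤ δ) (hδ : δ ≤ 1) (i : ℕ) :
    |(hasseDeriv i P).eval x| ≤ 4 ^ D * G * δ ^ (t - i) := by
  have hδ0 : 0 ≤ δ := (abs_nonneg _).trans hx
  rw [eval_hasseDeriv_eq_taylor P i x y]
  refine abs_eval_hasseDeriv_le_of_pow_le (t := t) ((natDegree_taylor P y).trans_le hdeg)
    (fun j => ?_) (fun j hj => ?_) (by positivity) fun j _ hj => ?_
  · rw [taylor_coeff]; exact hG j
  · rw [taylor_coeff]; exact ht j hj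
  · exact (pow_le_pow_left₀ (abs_nonneg _) hx _).trans (pow_le_pow_of_le_one hδ0 hδ (by omega))

lemma X_sub_C_pow_dvd_iff_hasseDeriv {P : ℝ[X]} {x : ℝ} {t : ℕ} :
    (X - C x) ^ t ∣ P ↔ ∀ l < t, (hasseDeriv l P).eval x = 0 := by
  rw [X_sub_C_pow_dvd_iff, ← taylor_apply, X_pow_dvd_iff]
  simp only [taylor_coeff]

/-- The numerator of the logarithmic derivative of `A / ((1 + X) ^ s * B)`. -/
def wronsk {R : Type*} [CommRing R] (s : ℕ) (A B : R[X]) : R[X] :=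
  (1 + X) * (derivative A * B - A * derivative B) - (s : R[X]) * (A * B)

lemma wronsk_sub {R : Type*} [CommRing R] (s : ℕ) (A B : R[X]) (c : R) :
    wronsk s (A - C c * ((1 + X) ^ s * B)) B = wronsk s A B := by
  unfold wronsk
  rcases s with _ | s
  · simp; ring
  · simp only [derivative_sub, derivative_mul, derivative_C, derivative_pow, derivative_add,
      derivative_one, derivative_X, Nat.add_sub_cancel, map_natCast]
    push_cast
    ring

lemma map_wronsk {R S : Type*} [CommRing R] [CommRing S] (f : R →+* S) (s : ℕ) (A B : R[X]) :
    (wronsk s A B).map f = wronsk s (A.map f) (B.map f) := by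
  simp [wronsk, derivative_map]

lemma pow_dvd_wronsk {P B : ℝ[X]} {x : ℝ} {t : ℕ} (s : ℕ) (h : (X - C x) ^ (t + 1) ∣ P) :
    (X - C x) ^ t ∣ wronsk s P B := by
  obtain ⟨Q, rfl⟩ := h
  refine ⟨(1 + X) * (C ((t : ℝ) + 1) * Q * B + (X - C x) * (derivative Q * B)
    - (X - C x) * (Q * derivative B)) - C (s : ℝ) * ((X - C x) * (Q * B)), ?_⟩
  simp only [wronsk, derivative_mul, derivative_X_sub_C_pow, Nat.add_sub_cancel]
  push_cast
  simp only [map_add, map_natCast, map_one]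
  ring

lemma natDegree_wronsk_le {R : Type*} [CommRing R] {s D : ℕ} {A B : R[X]}
    (hA : A.natDegree ≤ D) (hB : B.natDegree ≤ D) : (wronsk s A B).natDegree ≤ 2 * D := by
  unfold wronsk
  have h1 : ∀ P : R[X], P.natDegree ≤ D → ((1 + X) * derivative P).natDegree ≤ D := by
    intro P hP
    rcases Nat.eq_zero_or_pos P.natDegree with h | h
    · rw [natDegree_eq_zero.mp h |>.choose_spec.symm]; simp
    · refine natDegree_mul_le.trans ?_
      have h2 := natDegree_derivative_le P
      have h3 : (1 + X : R[X]).natDegree ≤ 1 := by compute_degree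
      omega
  have e : (1 + X) * (derivative A * B - A * derivative B) - (s : R[X]) * (A * B)
      = ((1 + X) * derivative A) * B - A * ((1 + X) * derivative B) - C (s : R) * (A * B) := by
    simp; ring
  rw [e]
  refine (natDegree_sub_le_of_le (natDegree_sub_le_of_le ?_ ?_) ?_).trans
    (max_le (max_le le_rfl le_rfl) le_rfl)
  · exact natDegree_mul_le.trans (by have := h1 A hA; omega)
  · exact natDegree_mul_le.trans (by have := h1 B hB; omega)
  · exact (natDegree_C_mul_le _ _).trans (natDegree_mul_le.trans (by omega))

lemma natDegree_eq_of_wronsk_eq_zero {s : ℕ} {A B : ℤ[X]} (hA : A ≠ 0) (hB : B ≠ 0)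
    (h : wronsk s A B = 0) : A.natDegree = B.natDegree + s := by
  have h1 : ∀ P : ℤ[X], ((1 + X) * derivative P).natDegree ≤ P.natDegree ∧
      ((1 + X) * derivative P).coeff P.natDegree = P.natDegree * P.leadingCoeff := by
    intro P
    rcases Nat.eq_zero_or_pos P.natDegree with h | h
    · have hc : P = C (P.coeff 0) := eq_C_of_natDegree_eq_zero h
      rw [hc]; simp
    · have h2 := natDegree_derivative_le P
      have h3 : (1 + X : ℤ[X]).natDegree ≤ 1 := by compute_degree
      refine ⟨natDegree_mul_le.trans (by omega), ?_⟩
      obtain ⟨d, hd⟩ : ∃ d, P.natDegree = d + 1 := ⟨P.natDegree - 1, by omega⟩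
      rw [add_mul, one_mul, coeff_add, hd, coeff_X_mul,
        coeff_eq_zero_of_natDegree_lt (by omega), coeff_derivative, leadingCoeff, hd]
      push_cast; ring
  have e : ((1 + X) * derivative A) * B - A * ((1 + X) * derivative B) - C (s : ℤ) * (A * B)
      = 0 := by
    rw [← h, wronsk]; simp; ring
  have h2 := congrArg (fun P => P.coeff (A.natDegree + B.natDegree)) e
  simp only [coeff_sub, coeff_C_mul, coeff_zero,
    coeff_mul_add_eq_of_natDegree_le (h1 A).1 le_rfl,
    coeff_mul_add_eq_of_natDegree_le le_rfl (h1 B).1,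
    coeff_mul_add_eq_of_natDegree_le (le_refl A.natDegree) (le_refl B.natDegree),
    (h1 A).2, (h1 B).2, coeff_natDegree] at h2
  have h3 : ((A.natDegree : ℤ) - B.natDegree - s) * (A.leadingCoeff * B.leadingCoeff) = 0 := by
    linear_combination h2
  rcases mul_eq_zero.mp h3 with h4 | h4
  · omega
  · simp [hA, hB] at h4

lemma sum_order_le_natDegree {W : ℝ[X]} {D : ℕ} (hW : W ≠ 0) (hD : W.natDegree ≤ D)
    {x : Fin 3 → ℝ} {y : ℝ} (hx : Function.Injective x) (hy : ∀ r, x r ≠ y) {μ ν : ℕ}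
    (h1 : ∀ r, (X - C (x r)) ^ μ ∣ W) (h2 : (X - C y) ^ ν ∣ W) : 3 * μ + ν ≤ D := by
  have h3 : ∏ r, (X - C (x r)) ^ μ ∣ W := by
    refine Finset.prod_dvd_of_coprime (fun i _ j _ hij => ?_) fun r _ => h1 r
    exact (isCoprime_X_sub_C_of_isUnit_sub
      (sub_ne_zero.mpr (hx.ne hij)).isUnit).pow
  have h4 : (∏ r, (X - C (x r)) ^ μ) * (X - C y) ^ ν ∣ W := by
    refine IsCoprime.mul_dvd (IsCoprime.prod_left fun r _ => ?_) h3 h2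
    exact (isCoprime_X_sub_C_of_isUnit_sub (sub_ne_zero.mpr (hy r)).isUnit).pow
  have h5 := natDegree_le_of_dvd h4 hW
  have h6 : ((∏ r, (X - C (x r)) ^ μ) * (X - C y) ^ ν).natDegree = 3 * μ + ν := by
    rw [Fin.prod_univ_three]
    have hm : ∀ (z : ℝ) (k : ℕ), ((X - C z) ^ k).Monic := fun z k => (monic_X_sub_C z).pow k
    rw [(((hm _ _).mul (hm _ _)).mul (hm _ _)).natDegree_mul (hm _ _),
      ((hm _ _).mul (hm _ _)).natDegree_mul (hm _ _), (hm _ _).natDegree_mul (hm _ _)]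
    simp only [natDegree_pow, natDegree_X_sub_C]
    ring
  omega

/-- Siegel's lemma for a pair of integer polynomials subject to linear conditions on their
coefficients. -/
lemma exists_polynomial_pair {ι : Type*} [Fintype ι] (D E : ℕ) (c d : ι → ℕ → ℤ) {G : ℝ}
    (hG : 1 ≤ G) (hc : ∀ i j, |(c i j : ℝ)| ≤ G) (hd : ∀ i j, |(d i j : ℝ)| ≤ G)
    (h0 : 0 < Fintype.card ι) (h1 : Fintype.card ι < 2 * D + 2)
    (hE : Fintype.card ι ≤ E * (2 * D + 2 - Fintype.card ι)) :
    ∃ A B : ℤ[X], A.natDegree ≤ D ∧ B.natDegree ≤ D ∧ (A ≠ 0 ∨ B ≠ 0) ∧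
      (∀ j, |(A.coeff j : ℝ)| ≤ ((2 * D + 2) * G) ^ E) ∧
      (∀ j, |(B.coeff j : ℝ)| ≤ ((2 * D + 2) * G) ^ E) ∧
      ∀ i, ∑ j ∈ Finset.range (D + 1), (c i j * A.coeff j + d i j * B.coeff j) = 0 := by
  classical
  let M : Matrix ι (Fin (D + 1) ⊕ Fin (D + 1)) ℤ :=
    Matrix.of fun i => Sum.elim (fun j => c i j) (fun j => d i j)
  have hcard : Fintype.card (Fin (D + 1) ⊕ Fin (D + 1)) = 2 * D + 2 := by simp; ring
  let _ : SeminormedAddCommGroup (Matrix ι (Fin (D + 1) ⊕ Fin (D + 1)) ℤ) :=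
    Matrix.seminormedAddCommGroup
  obtain ⟨t, ht0, htM, htn⟩ := Int.Matrix.exists_ne_zero_int_vec_norm_le M (by omega) h0
  have hMn : ‖M‖ ≤ G := by
    rw [Matrix.norm_le_iff (by positivity)]
    rintro i (j | j)
    · simpa [M, Int.norm_eq_abs] using hc i j
    · simpa [M, Int.norm_eq_abs] using hd i j
  have hbound : ∀ j, |(t j : ℝ)| ≤ ((2 * D + 2) * G) ^ E := by
    intro j
    rw [← Int.norm_eq_abs]
    refine (norm_le_pi_norm t j).trans (htn.trans ?_)
    rw [hcard]
    have hb : (1 : ℝ) ≤ (2 * D + 2) * G := by nlinarith [(Nat.cast_nonneg D : (0 : ℝ) ≤ D)]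
    have hb' : ((2 * D + 2 : ℕ) : ℝ) * max 1 ‖M‖ ≤ (2 * D + 2) * G := by
      push_cast
      gcongr
      exact max_le hG hMn
    calc _ ≤ ((2 * D + 2) * G) ^
          ((Fintype.card ι : ℝ) / ((2 * D + 2 : ℕ) - (Fintype.card ι : ℝ))) := by
          refine Real.rpow_le_rpow (by positivity) hb' ?_
          exact div_nonneg (by positivity) (sub_nonneg.mpr (by exact_mod_cast h1.le))
      _ ≤ ((2 * D + 2) * G) ^ (E : ℝ) := by
          refine Real.rpow_le_rpow_of_exponent_le hb ?_
          rw [div_le_iff₀ (sub_pos.mpr (by exact_mod_cast h1)), ← Nat.cast_sub h1.le]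
          exact_mod_cast hE
      _ = _ := Real.rpow_natCast _ _
  have hpoly : ∀ u : Fin (D + 1) → ℤ, ∃ A : ℤ[X], A.natDegree ≤ D ∧
      (∀ j : Fin (D + 1), A.coeff j = u j) ∧ ∀ j, D < j → A.coeff j = 0 := by
    intro u
    let A : ℤ[X] := ∑ j ∈ Finset.range (D + 1),
      monomial j (if h : j < D + 1 then u ⟨j, h⟩ else 0)
    have hcoef : ∀ j, A.coeff j = if h : j < D + 1 then u ⟨j, h⟩ else 0 := by
      intro j
      simp only [A, finsetSum_coeff, coeff_monomial]
      rw [Finset.sum_ite_eq' (Finset.range (D + 1)) j]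
      by_cases h : j < D + 1 <;> simp [h]
    have hz : ∀ j, D < j → A.coeff j = 0 := fun j hj => by rw [hcoef]; simp; omega
    exact ⟨A, natDegree_le_iff_coeff_eq_zero.mpr hz, fun j => by rw [hcoef, dif_pos j.2], hz⟩
  obtain ⟨A, hA, hA1, hA2⟩ := hpoly fun j => t (Sum.inl j)
  obtain ⟨B, hB, hB1, hB2⟩ := hpoly fun j => t (Sum.inr j)
  have hcf : ∀ (P : ℤ[X]) (f : Fin (D + 1) → Fin (D + 1) ⊕ Fin (D + 1)),
      (∀ j : Fin (D + 1), P.coeff j = t (f j)) → (∀ j, D < j → P.coeff j = 0) →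
      ∀ j, |(P.coeff j : ℝ)| ≤ ((2 * D + 2) * G) ^ E := by
    intro P f hP hP' j
    by_cases h : D < j
    · rw [hP' j h]; simp; positivity
    · rw [hP ⟨j, by omega⟩]; exact hbound _
  refine ⟨A, B, hA, hB, ?_, hcf A _ hA1 hA2, hcf B _ hB1 hB2, fun i => ?_⟩
  · by_contra hcon
    push Not at hcon
    apply ht0
    funext j
    rcases j with j | j
    · rw [← hA1, hcon.1]; simp
    · rw [← hB1, hcon.2]; simp
  · have := congrFun htM i
    simp only [Matrix.mulVec, dotProduct, Fintype.sum_sum_type, M, Matrix.of_apply,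
      Sum.elim_inl, Sum.elim_inr, Pi.zero_apply, ← hA1, ← hB1] at this
    rw [← this, ← Finset.sum_add_distrib,
      Finset.sum_range fun j => c i j * A.coeff j + d i j * B.coeff j]

end Polynomials

section CyclicCubic

open Polynomial

/-- `l` lists the roots of `f_n` so that the Galois action `z ↦ -1 / (1 + z)` is the index shift. -/
structure CyclicRoots (n : ℤ) (l : Fin 3 → ℝ) : Prop where
  root : ∀ r, fn n (l r) = 0
  cyc : ∀ r, l (r + 1) * (1 + l r) = -1
  inj : Function.Injective l

/-- The polynomial `f_n` with integer coefficients. -/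
def fnPoly (n : ℤ) : ℤ[X] := X ^ 3 - C (n - 1) * X ^ 2 - C (n + 2) * X - 1

lemma fnPoly_natDegree (n : ℤ) : (fnPoly n).natDegree = 3 := by
  unfold fnPoly
  compute_degree!

lemma fnPoly_monic (n : ℤ) : (fnPoly n).Monic := by
  have h : (fnPoly n).coeff 3 = 1 := by
    rw [fnPoly]
    compute_degree!
  rwa [Monic, leadingCoeff, fnPoly_natDegree]

lemma aeval_fnPoly (n : ℤ) (x : ℝ) : aeval x (fnPoly n) = fn n x := by
  simp [fnPoly, fn, map_ofNat]

lemma irreducible_fnPoly_map (n : ℤ) : Irreducible ((fnPoly n).map (Int.castRingHom ℚ)) := by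
  have hm := (fnPoly_monic n).map (Int.castRingHom ℚ)
  have hd : ((fnPoly n).map (Int.castRingHom ℚ)).natDegree = 3 := by
    rw [(fnPoly_monic n).natDegree_map, fnPoly_natDegree]
  rw [hm.irreducible_iff_roots_eq_zero_of_degree_le_three (by omega) (by omega)]
  refine Multiset.eq_zero_of_forall_notMem fun q hq => ?_
  rw [mem_roots hm.ne_zero, IsRoot, eval_map] at hq
  obtain ⟨z, rfl⟩ := isInteger_of_is_root_of_monic (fnPoly_monic n) (r := q) hq
  have h1 : z * (z ^ 2 - (n - 1) * z - (n + 2)) = 1 := by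
    have h2 : ((z : ℚ) ^ 3 - (n - 1) * z ^ 2 - (n + 2) * z - 1) = 0 := by
      simpa [fnPoly] using hq
    have h3 : z ^ 3 - (n - 1) * z ^ 2 - (n + 2) * z - 1 = 0 := by exact_mod_cast h2
    linear_combination h3
  rcases Int.eq_one_or_neg_one_of_mul_eq_one h1 with rfl | rfl
  · omega
  · omega

/-- The conjugate vectors of the elements of `ℤ[λ]`. -/
def conjRing (l : Fin 3 → ℝ) : Subring (Fin 3 → ℝ) :=
  (RingHom.pi fun r => (aeval (R := ℤ) (l r)).toRingHom).range

lemma mem_conjRing {l v : Fin 3 → ℝ} : v ∈ conjRing l ↔ ∃ Φ : ℤ[X], ∀ r, aeval (l r) Φ = v r := by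
  simp only [conjRing, RingHom.mem_range, funext_iff]
  rfl

lemma root_mem_conjRing (l : Fin 3 → ℝ) : l ∈ conjRing l := mem_conjRing.mpr ⟨X, by simp⟩

lemma aeval_mem_conjRing {l v : Fin 3 → ℝ} (hv : v ∈ conjRing l) (P : ℤ[X]) :
    (fun r => aeval (v r) P) ∈ conjRing l := by
  obtain ⟨Φ, hΦ⟩ := mem_conjRing.mp hv
  exact mem_conjRing.mpr ⟨P.comp Φ, fun r => by rw [aeval_comp, hΦ]⟩

lemma eval_hasseDeriv_map (W : ℤ[X]) (i : ℕ) (x : ℝ) :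
    (hasseDeriv i (W.map (Int.castRingHom ℝ))).eval x = aeval x (hasseDeriv i W) := by
  rw [aeval_def, ← eval_map]
  congr 1
  ext j
  simp [hasseDeriv_coeff]

lemma eval_hasseDeriv_mem_conjRing {l v : Fin 3 → ℝ} (hv : v ∈ conjRing l) (P : ℤ[X]) (i : ℕ) :
    (fun r => (hasseDeriv i (P.map (Int.castRingHom ℝ))).eval (v r)) ∈ conjRing l := by
  simp only [eval_hasseDeriv_map]
  exact aeval_mem_conjRing hv _

namespace CyclicRoots

variable {n : ℤ} {l : Fin 3 → ℝ}

lemma rotate (hl : CyclicRoots n l) (k : Fin 3) : CyclicRoots n fun r => l (r + k) where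
  root r := hl.root _
  cyc r := by simpa only [add_right_comm r 1 k] using hl.cyc (r + k)
  inj := hl.inj.comp (add_left_injective k)

lemma ne_zero (hl : CyclicRoots n l) (r : Fin 3) : l r ≠ 0 := fun h => by
  have := hl.root r
  simp [fn, h] at this

lemma succ_eq (hl : CyclicRoots n l) (r : Fin 3) : l (r + 1) = l r ^ 2 - n * l r - 2 := by
  have h1 := hl.cyc r
  have h2 : (1 + l r) ≠ 0 := fun h => by simp [h] at h1
  have h3 := hl.root r
  apply mul_right_cancel₀ h2
  unfold fn at h3
  linear_combination h1 - h3

lemma inv_eq (hl : CyclicRoots n l) (r : Fin 3) :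
    (l r)⁻¹ = l r ^ 2 - (n - 1) * l r - (n + 2) := by
  have h3 := hl.root r
  unfold fn at h3
  apply inv_eq_of_mul_eq_one_left
  linear_combination h3

lemma inv_mem (hl : CyclicRoots n l) : (fun r => (l r)⁻¹) ∈ conjRing l :=
  mem_conjRing.mpr ⟨X ^ 2 - C (n - 1) * X - C (n + 2), fun r => by
    simp [hl.inv_eq, map_ofNat]⟩

lemma shift_mem (hl : CyclicRoots n l) {v : Fin 3 → ℝ} (hv : v ∈ conjRing l) (k : Fin 3) :
    (fun r => v (r + k)) ∈ conjRing l := by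
  have h1 : ∀ {w : Fin 3 → ℝ}, w ∈ conjRing l → (fun r => w (r + 1)) ∈ conjRing l := by
    intro w hw
    obtain ⟨Φ, hΦ⟩ := mem_conjRing.mp hw
    refine mem_conjRing.mpr ⟨Φ.comp (X ^ 2 - C n * X - 2), fun r => ?_⟩
    rw [aeval_comp, ← hΦ, hl.succ_eq]
    simp [map_ofNat]
  fin_cases k
  · simpa using hv
  · exact h1 hv
  · have := h1 (h1 hv)
    simp only [add_assoc] at this
    exact this

lemma vieta (hl : CyclicRoots n l) : l 0 + l 1 + l 2 = n - 1 ∧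
    l 0 * l 1 + l 1 * l 2 + l 2 * l 0 = -(n + 2) ∧ l 0 * l 1 * l 2 = 1 := by
  have h0 := hl.root 0
  have h1 := hl.root 1
  have h2 := hl.root 2
  have d01 : l 0 - l 1 ≠ 0 := sub_ne_zero.mpr (hl.inj.ne (by decide))
  have d02 : l 0 - l 2 ≠ 0 := sub_ne_zero.mpr (hl.inj.ne (by decide))
  have d12 : l 1 - l 2 ≠ 0 := sub_ne_zero.mpr (hl.inj.ne (by decide))
  unfold fn at h0 h1 h2
  have q01 : l 0 ^ 2 + l 0 * l 1 + l 1 ^ 2 - (n - 1) * (l 0 + l 1) - (n + 2) = 0 := by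
    apply mul_left_cancel₀ d01; linear_combination h0 - h1
  have q02 : l 0 ^ 2 + l 0 * l 2 + l 2 ^ 2 - (n - 1) * (l 0 + l 2) - (n + 2) = 0 := by
    apply mul_left_cancel₀ d02; linear_combination h0 - h2
  have e1 : l 0 + l 1 + l 2 = n - 1 := by
    apply mul_left_cancel₀ d12; linear_combination q01 - q02
  have e2 : l 0 * l 1 + l 1 * l 2 + l 2 * l 0 = -(n + 2) := by
    linear_combination (l 0 + l 1) * e1 - q01
  exact ⟨e1, e2, by linear_combination h0 - l 0 ^ 2 * e1 + l 0 * e2⟩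

lemma apply_eq_zero (hl : CyclicRoots n l) {v : Fin 3 → ℝ} (hv : v ∈ conjRing l) {s : Fin 3}
    (h : v s = 0) (r : Fin 3) : v r = 0 := by
  obtain ⟨Φ, hΦ⟩ := mem_conjRing.mp hv
  have hroot : ∀ r, aeval (l r) ((fnPoly n).map (Int.castRingHom ℚ)) = 0 := by
    intro r
    rw [← algebraMap_int_eq, aeval_map_algebraMap, aeval_fnPoly, hl.root]
  have hmin := minpoly.eq_of_irreducible_of_monic (irreducible_fnPoly_map n) (hroot s)
    ((fnPoly_monic n).map _)
  have hdvd : minpoly ℚ (l s) ∣ Φ.map (Int.castRingHom ℚ) := by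
    apply minpoly.dvd
    rw [← algebraMap_int_eq, aeval_map_algebraMap, hΦ, h]
  rw [← hmin] at hdvd
  obtain ⟨Q, hQ⟩ := hdvd
  have := congrArg (aeval (l r)) hQ
  rwa [map_mul, hroot, zero_mul, ← algebraMap_int_eq, aeval_map_algebraMap, hΦ] at this

lemma exists_eq_quadratic (hl : CyclicRoots n l) {v : Fin 3 → ℝ} (hv : v ∈ conjRing l) :
    ∃ a b c : ℤ, ∀ r, v r = a + b * l r + c * l r ^ 2 := by
  obtain ⟨Φ, hΦ⟩ := mem_conjRing.mp hv
  have hdeg : (Φ %ₘ fnPoly n).natDegree < 3 := by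
    have := natDegree_modByMonic_lt Φ (fnPoly_monic n) fun h => by
      have := fnPoly_natDegree n
      rw [h] at this; simp at this
    rwa [fnPoly_natDegree] at this
  refine ⟨(Φ %ₘ fnPoly n).coeff 0, (Φ %ₘ fnPoly n).coeff 1, (Φ %ₘ fnPoly n).coeff 2,
    fun r => ?_⟩
  have e := congrArg (aeval (l r)) (modByMonic_add_div Φ (fnPoly n))
  rw [map_add, map_mul, aeval_fnPoly, hl.root, zero_mul, add_zero, hΦ] at e
  rw [← e, aeval_eq_sum_range' hdeg]
  simp only [Finset.sum_range_succ, Finset.sum_range_zero, zero_add, pow_zero, pow_one,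
    zsmul_eq_mul, mul_one]

lemma exists_norm_eq (hl : CyclicRoots n l) {v : Fin 3 → ℝ} (hv : v ∈ conjRing l) :
    ∃ z : ℤ, v 0 * v 1 * v 2 = z := by
  obtain ⟨a, b, c, h⟩ := hl.exists_eq_quadratic hv
  obtain ⟨h1, h2, h3⟩ := hl.vieta
  refine ⟨a ^ 3 + a ^ 2 * b * (n - 1) + a ^ 2 * c * ((n - 1) ^ 2 + 2 * (n + 2))
    - a * b ^ 2 * (n + 2) + a * b * c * (-(n - 1) * (n + 2) - 3)
    + a * c ^ 2 * ((n + 2) ^ 2 - 2 * (n - 1)) + b ^ 3 + b ^ 2 * c * (n - 1)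
    - b * c ^ 2 * (n + 2) + c ^ 3, ?_⟩
  have h2' : (n + 2 : ℝ) = -(l 0 * l 1 + l 1 * l 2 + l 2 * l 0) := by linear_combination h2
  push_cast
  rw [h, h, h, ← h1, h2']
  generalize l 0 = x at *
  generalize l 1 = y at *
  generalize l 2 = z at *
  linear_combination (b ^ 3 + c ^ 3 * (x * y * z + 1) - 3 * a * b * c - 2 * a * c ^ 2 * (x + y + z)
    + b ^ 2 * c * (x + y + z) + b * c ^ 2 * (x * y + y * z + z * x)) * h3

/-- The norm of a nonzero element of `ℤ[λ]` is at least one in absolute value. -/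
lemma one_le_abs_norm (hl : CyclicRoots n l) {v : Fin 3 → ℝ} (hv : v ∈ conjRing l) {s : Fin 3}
    (h : v s ≠ 0) : 1 ≤ |v 0| * |v 1| * |v 2| := by
  obtain ⟨z, hz⟩ := hl.exists_norm_eq hv
  have hne : ∀ r, v r ≠ 0 := fun r hr => h (hl.apply_eq_zero hv hr s)
  have hz0 : z ≠ 0 := fun h0 => by
    rw [h0, Int.cast_zero] at hz
    exact mul_ne_zero (mul_ne_zero (hne 0) (hne 1)) (hne 2) hz
  rw [← abs_mul, ← abs_mul, hz]
  exact_mod_cast Int.one_le_abs hz0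

/-- Vanishing orders of integer polynomials are Galois invariant. -/
lemma X_sub_C_pow_dvd_map (hl : CyclicRoots n l) {v : Fin 3 → ℝ} (hv : v ∈ conjRing l)
    {W : ℤ[X]} {s : Fin 3} {t : ℕ} (h : (X - C (v s)) ^ t ∣ W.map (Int.castRingHom ℝ))
    (r : Fin 3) : (X - C (v r)) ^ t ∣ W.map (Int.castRingHom ℝ) := by
  rw [X_sub_C_pow_dvd_iff_hasseDeriv] at h ⊢
  exact fun i hi => hl.apply_eq_zero (eval_hasseDeriv_mem_conjRing hv W i) (h i hi) r

lemma abs_ne (hl : CyclicRoots n l) {i j : Fin 3} (hij : i ≠ j) : |l i| ≠ |l j| := by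
  intro h
  rcases abs_eq_abs.mp h with h | h
  · exact hij (hl.inj h)
  have hv := (conjRing l).add_mem (root_mem_conjRing l)
    (hl.shift_mem (root_mem_conjRing l) (j - i))
  have h0 := hl.apply_eq_zero hv (s := i) (by simp [h])
  have h1 := h0 i
  have h2 := h0 (i + (j - i))
  simp only [Pi.add_apply] at h1 h2
  have h3 : ∀ i j : Fin 3, i = i + (j - i) + (j - i) → i = j := by decide
  exact hij (h3 i j (hl.inj (by linear_combination h1 - h2)))

end CyclicRoots

end CyclicCubic

section BinomialApproximation

open Polynomial

lemma abs_coeff_one_add_X_pow_mul_le {s : ℕ} {B : ℤ[X]} {H : ℝ}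
    (hB : ∀ j, |(B.coeff j : ℝ)| ≤ H) (j : ℕ) :
    |(((1 + X) ^ s * B).coeff j : ℝ)| ≤ 2 ^ s * H := by
  have hH : 0 ≤ H := (abs_nonneg _).trans (hB 0)
  induction s generalizing j with
  | zero => simpa using hB j
  | succ s ih =>
    have e : (1 + X) ^ (s + 1) * B = (1 + X) ^ s * B + X * ((1 + X) ^ s * B) := by ring
    have h1 : |((X * ((1 + X) ^ s * B)).coeff j : ℝ)| ≤ 2 ^ s * H := by
      rcases j with _ | j
      · simpa using by positivity
      · rw [coeff_X_mul]; exact ih j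
    rw [e, coeff_add, Int.cast_add]
    refine (abs_add_le _ _).trans ((add_le_add (ih j) h1).trans_eq ?_)
    ring

/-- Padé-type approximations `A / B` to `(1 + X) ^ s`, obtained from Siegel's lemma. -/
lemma exists_binomial_approximation {e s : ℕ} (he : 1 ≤ e) (h1 : 10 * e ≤ s) (h2 : s ≤ 20 * e) :
    ∃ A B : ℤ[X], A.natDegree ≤ 6 * e ∧ B.natDegree ≤ 6 * e ∧
      (∀ j, |(A.coeff j : ℝ)| ≤ 2 ^ (120 * e)) ∧ (∀ j, |(B.coeff j : ℝ)| ≤ 2 ^ (120 * e)) ∧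
      X ^ (10 * e) ∣ A - (1 + X) ^ s * B ∧ wronsk s A B ≠ 0 := by
  obtain ⟨A, B, hA, hB, hne, hcA, hcB, hlin⟩ := exists_polynomial_pair (ι := Fin (10 * e)) (6 * e) 5
    (fun i j => if j = i then 1 else 0)
    (fun i j => if j ≤ i then -(s.choose (i - j) : ℤ) else 0)
    (G := 2 ^ s) (one_le_pow₀ (by norm_num))
    (fun i j => by
      split_ifs
      · simpa using one_le_pow₀ (by norm_num : (1 : ℝ) ≤ 2)
      · simp)
    (fun i j => by
      split_ifs
      · simp only [Int.cast_neg, Int.cast_natCast, abs_neg, Nat.abs_cast]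
        exact_mod_cast Nat.choose_le_two_pow _ _
      · simp)
    (by simp; omega) (by simp; omega) (by simp; omega)
  have hbd : ((2 * (6 * e : ℕ) + 2) * (2 : ℝ) ^ s) ^ 5 ≤ 2 ^ (120 * e) := by
    have h3 : (2 * ((6 * e : ℕ) : ℝ) + 2) ≤ 2 ^ (4 * e) := by
      have h4 : 2 * (6 * e) + 2 ≤ 2 ^ (4 * e) := by
        clear * - he
        induction e, he using Nat.le_induction with
        | base => norm_num
        | succ e he ih => rw [show 4 * (e + 1) = 4 * e + 4 by ring, pow_add]; omega
      exact_mod_cast h4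
    calc ((2 * (6 * e : ℕ) + 2) * (2 : ℝ) ^ s) ^ 5 ≤ (2 ^ (4 * e) * 2 ^ (20 * e)) ^ 5 := by
          gcongr
          norm_num
      _ = 2 ^ (120 * e) := by rw [← pow_add, ← pow_mul]; congr 1; ring
  have hdvd : X ^ (10 * e) ∣ A - (1 + X) ^ s * B := by
    rw [X_pow_dvd_iff]
    intro i hi
    have h3 := hlin ⟨i, hi⟩
    have hBs := B.as_sum_range' (6 * e + 1) (by omega)
    have h4 : ((1 + X) ^ s * B).coeff i
        = ∑ j ∈ Finset.range (6 * e + 1),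
          (if j ≤ i then (s.choose (i - j) : ℤ) else 0) * B.coeff j := by
      conv_lhs => rw [hBs]
      rw [Finset.mul_sum, finsetSum_coeff]
      refine Finset.sum_congr rfl fun j _ => ?_
      rw [← C_mul_X_pow_eq_monomial, mul_left_comm, coeff_C_mul, coeff_mul_X_pow',
        coeff_one_add_X_pow]
      split_ifs <;> simp [mul_comm]
    have h5 : A.coeff i = ∑ j ∈ Finset.range (6 * e + 1), (if j = i then 1 else 0) * A.coeff j := by
      simp only [ite_mul, one_mul, zero_mul, Finset.sum_ite_eq', Finset.mem_range]
      split_ifs with h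
      · rfl
      · exact coeff_eq_zero_of_natDegree_lt (by omega)
    rw [coeff_sub, h4, h5, ← Finset.sum_sub_distrib]
    refine Eq.trans (Finset.sum_congr rfl fun j _ => ?_) h3
    split_ifs <;> ring
  have hzero : ∀ P : ℤ[X], P.natDegree ≤ 6 * e → X ^ (10 * e) ∣ P → P = 0 := by
    intro P hP hd
    by_contra h0
    have := natDegree_le_of_dvd hd h0
    rw [natDegree_X_pow] at this
    omega
  have hB0 : B ≠ 0 := by
    rintro rfl
    exact hne.elim (fun h => h (hzero A hA (by simpa using hdvd))) fun h => h rfl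
  have hA0 : A ≠ 0 := by
    rintro rfl
    refine hB0 (hzero B hB ?_)
    rw [zero_sub, dvd_neg] at hdvd
    refine IsCoprime.dvd_of_dvd_mul_left (IsCoprime.pow ?_) hdvd
    exact ⟨-1, 1, by ring⟩
  refine ⟨A, B, hA, hB, fun j => (hcA j).trans hbd, fun j => (hcB j).trans hbd, hdvd, fun hw => ?_⟩
  have := natDegree_eq_of_wronsk_eq_zero hA0 hB0 hw
  omega

end BinomialApproximation

section LargeRoot

open Polynomial

namespace CyclicRoots

variable {n : ℤ} {l : Fin 3 → ℝ}

lemma exists_combination_ne_zero (hl : CyclicRoots n l) {u : Fin 3 → ℝ} (h0 : u 0 ≠ 0)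
    {e s : ℕ} (he : 2 ≤ e) {A B : ℤ[X]} (hA : A.natDegree ≤ 6 * e) (hB : B.natDegree ≤ 6 * e)
    (hdvd : X ^ (10 * e) ∣ A - (1 + X) ^ s * B) (hW : wronsk s A B ≠ 0) :
    ∃ i ≤ e, u 0 * (hasseDeriv i (A.map (Int.castRingHom ℝ))).eval (l 0)⁻¹ +
      u 1 * (hasseDeriv i (((1 + X) ^ s * B).map (Int.castRingHom ℝ))).eval (l 0)⁻¹ ≠ 0 := by
  by_contra! h
  let φ := Int.castRingHom ℝ
  have hS : ((1 + X) ^ s * B).map φ = (1 + X) ^ s * B.map φ := by simp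
  have h1 : (X - C (l 0)⁻¹) ^ (e + 1) ∣ A.map φ - C (-u 1 / u 0) * ((1 + X) ^ s * B.map φ) := by
    rw [X_sub_C_pow_dvd_iff_hasseDeriv]
    intro i hi
    have h2 := h i (by omega)
    rw [hS] at h2
    change _ * (hasseDeriv i (A.map φ)).eval _ + _ = _ at h2
    rw [map_sub, ← smul_eq_C_mul, LinearMap.map_smul, eval_sub, eval_smul, smul_eq_mul]
    apply mul_left_cancel₀ h0
    field_simp
    simp only [one_div]
    linear_combination h2
  have h2 := pow_dvd_wronsk (B := B.map φ) s h1
  rw [wronsk_sub, ← map_wronsk] at h2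
  have h3 : (X - C (0 : ℝ)) ^ (10 * e - 1) ∣ (wronsk s A B).map φ := by
    rw [map_wronsk, ← wronsk_sub s _ _ 1]
    apply pow_dvd_wronsk
    have h4 := (mapRingHom φ).map_dvd hdvd
    rw [Nat.sub_add_cancel (by omega)]
    simpa using h4
  have h5 := sum_order_le_natDegree (W := (wronsk s A B).map φ) (D := 12 * e)
    (x := fun r => (l r)⁻¹) (y := 0)
    (by rwa [Ne, Polynomial.map_eq_zero_iff Int.cast_injective])
    (natDegree_map_le.trans ((natDegree_wronsk_le hA hB).trans (by omega)))
    (fun i j hij => hl.inj (inv_injective hij)) (fun r => inv_ne_zero (hl.ne_zero r))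
    (fun r => hl.X_sub_C_pow_dvd_map (v := fun r => (l r)⁻¹) hl.inv_mem h2 r) h3
  omega

set_option maxHeartbeats 1000000 in
/-- An elementary form of the effective bound for large roots: `u` is a solution of
`u 0 + u 1 + u 2 = 0` whose last conjugate is much smaller than the other two. -/
lemma log_le_of_large (hl : CyclicRoots n l) {k : ℕ} (hk : k = 735)
    (hL : 2 ^ k ≤ l 0) {u : Fin 3 → ℝ}
    (hu : u ∈ conjRing l) (hsum : u 0 + u 1 + u 2 = 0) (h0 : u 0 ≠ 0) {Y U : ℝ} (hY : 1 ≤ Y)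
    (hU : 1 ≤ U) (hu0 : |u 0| ≤ U * Y) (hu1 : |u 1| ≤ U * Y) (hu2 : |u 2| ≤ U / Y ^ 2) :
    Real.log Y ≤ 17 * (Real.log U + Real.log (l 0)) := by
  set L := l 0 with hLdef
  have hL2 : (2 : ℝ) ≤ L := (le_self_pow₀ (by norm_num) (by omega)).trans hL
  have hL0 : 0 < L := by linarith
  have hY0 : 0 < Y := by linarith
  have hU0 : 0 < U := by linarith
  have hlogL : Real.log 2 ≤ Real.log L := Real.log_le_log (by norm_num) hL2
  have hlog2 : 0 < Real.log 2 := Real.log_pos (by norm_num)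
  have hlogU : 0 ≤ Real.log U := Real.log_nonneg hU
  obtain ⟨s, hs1, hs2⟩ := exists_nat_pow_near (one_le_pow₀ (n := 3) hY) (show 1 < L by linarith)
  have hlogY : 3 * Real.log Y ≤ (s + 1) * Real.log L := by
    have := Real.log_le_log (by positivity) hs2.le
    rw [Real.log_pow, Real.log_pow] at this
    push_cast at this
    exact this
  rcases lt_or_ge s 20 with hs | hs
  · have : (s : ℝ) ≤ 19 := by exact_mod_cast Nat.le_of_lt_succ hs
    nlinarith
  obtain ⟨e, he⟩ : ∃ e, e = s / 10 := ⟨_, rfl⟩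
  have he2 : 2 ≤ e := by omega
  have hes : 10 * e ≤ s := by omega
  have hse : s ≤ 20 * e := by omega
  obtain ⟨A, B, hA, hB, hcA, hcB, hdvd, hW⟩ := exists_binomial_approximation (by omega) hes hse
  obtain ⟨i, hi, hv⟩ := hl.exists_combination_ne_zero h0 he2 hA hB hdvd hW
  set S := (1 + X) ^ s * B with hSdef
  set φ := Int.castRingHom ℝ
  set A' := A.map φ with hA'
  set S' := S.map φ with hS'
  let θ : Fin 3 → ℝ := fun r => (l r)⁻¹
  have hvmem : (fun r => u r * (hasseDeriv i A').eval (θ r) +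
      u (r + 1) * (hasseDeriv i S').eval (θ r)) ∈ conjRing l :=
    (conjRing l).add_mem ((conjRing l).mul_mem hu (eval_hasseDeriv_mem_conjRing hl.inv_mem A i))
      ((conjRing l).mul_mem (hl.shift_mem hu 1) (eval_hasseDeriv_mem_conjRing hl.inv_mem S i))
  have hnorm := hl.one_le_abs_norm hvmem (s := 0) hv
  simp only [zero_add, show (1 : Fin 3) + 1 = 2 from rfl, show (2 : Fin 3) + 1 = 0 from rfl]
    at hnorm
  -- sizes of the polynomials
  have hdS : S.natDegree ≤ s + 6 * e := by
    refine natDegree_mul_le.trans (add_le_add ?_ hB)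
    refine natDegree_pow_le.trans ?_
    have h3 : (1 + X : ℤ[X]).natDegree ≤ 1 := by compute_degree
    nlinarith
  have hcS : ∀ j, |(S.coeff j : ℝ)| ≤ 2 ^ (140 * e) := fun j => by
    refine (abs_coeff_one_add_X_pow_mul_le hcB j).trans ?_
    rw [← pow_add]
    exact pow_le_pow_right₀ (by norm_num) (by omega)
  have hdA' : A'.natDegree ≤ 6 * e := natDegree_map_le.trans hA
  have hdS' : S'.natDegree ≤ s + 6 * e := natDegree_map_le.trans hdS
  have hcA' : ∀ j, |A'.coeff j| ≤ 2 ^ (120 * e) := fun j => by simpa [A', φ] using hcA j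
  have hcS' : ∀ j, |S'.coeff j| ≤ 2 ^ (140 * e) := fun j => by
    rw [hS', coeff_map]; simpa [φ] using hcS j
  have hcR : ∀ j, |(A' - S').coeff j| ≤ 2 ^ (141 * e) := fun j => by
    rw [coeff_sub]
    refine (abs_sub _ _).trans ((add_le_add (hcA' j) (hcS' j)).trans ?_)
    have h1 : (2 : ℝ) ^ (120 * e) ≤ 2 ^ (140 * e) := pow_le_pow_right₀ (by norm_num) (by omega)
    have h2 : (2 : ℝ) ^ (140 * e + 1) ≤ 2 ^ (141 * e) :=
      pow_le_pow_right₀ (by norm_num) (by omega)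
    rw [pow_succ] at h2
    linarith
  -- sizes of the values
  set Z : ℝ := 2 ^ (245 * e) with hZdef
  set P := L ^ e with hPdef
  have hP : 0 < P := by positivity
  have hZ0 : 0 < Z := by positivity
  have hZ : ∀ a b : ℕ, 2 * a + b ≤ 245 * e → (4 : ℝ) ^ a * 2 ^ b ≤ Z := fun a b hab => by
    rw [show (4 : ℝ) = 2 ^ 2 by norm_num, ← pow_mul, ← pow_add]
    exact pow_le_pow_right₀ (by norm_num) hab
  have hZP : Z ^ 3 ≤ P := by
    rw [hZdef, hPdef, ← pow_mul, show 245 * e * 3 = k * e by rw [hk]; ring, pow_mul]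
    exact pow_le_pow_left₀ (by positivity) hL e
  have hLs : 0 < L ^ s := by positivity
  have hθ0 : |θ 0| ≤ L⁻¹ := (abs_of_pos (inv_pos.mpr hL0)).le
  have hLi : L⁻¹ ≤ 1 := inv_le_one_of_one_le₀ (by linarith)
  have hl1 : l 1 * (1 + L) = -1 := hl.cyc 0
  have hl2 : l 2 * (1 + l 1) = -1 := hl.cyc 1
  have hL1 : 1 + L ≠ 0 := by positivity
  have hθe1 : θ 1 = -(1 + L) := inv_eq_of_mul_eq_one_right (by linear_combination -hl1)
  have hθe2 : θ 2 = -1 - l 1 := inv_eq_of_mul_eq_one_right (by linear_combination -hl2)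
  have hl1e : l 1 = -(1 + L)⁻¹ := by field_simp; linarith
  have hinv : (1 + L)⁻¹ ≤ L⁻¹ := inv_anti₀ hL0 (by linarith)
  have hinv0 : 0 < (1 + L)⁻¹ := by positivity
  have hθ1 : |θ 1| ≤ 2 * L := by rw [hθe1, abs_neg, abs_of_pos] <;> linarith
  have hθ2 : |θ 2| ≤ 1 := by rw [hθe2, hl1e, abs_le]; constructor <;> linarith
  have hθ2' : |θ 2 - (-1)| ≤ L⁻¹ := by rw [hθe2, hl1e, abs_le]; constructor <;> linarith
  have bR : |(hasseDeriv i (A' - S')).eval (θ 0)| ≤ Z * (P⁻¹) ^ 9 := by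
    refine (abs_eval_hasseDeriv_le_of_pow_le (D := 26 * e) (t := 10 * e) (E := L⁻¹ ^ (9 * e))
      ((natDegree_sub_le _ _).trans (by omega)) hcR (fun j hj => ?_) (by positivity)
      fun j _ hj => ?_).trans ?_
    · have h1 := X_pow_dvd_iff.mp hdvd j hj
      rw [hA', hS', ← Polynomial.map_sub, coeff_map, h1, map_zero]
    · exact (pow_le_pow_left₀ (abs_nonneg _) hθ0 _).trans
        (pow_le_pow_of_le_one (by positivity) hLi (by omega))
    · rw [hPdef, ← inv_pow, ← pow_mul, mul_comm e 9]
      exact mul_le_mul_of_nonneg_right (hZ _ _ (by omega)) (by positivity)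
  have bS0 : |(hasseDeriv i S').eval (θ 0)| ≤ Z := by
    refine (abs_eval_hasseDeriv_le (D := 26 * e) (by omega) hcS' (hθ0.trans hLi) le_rfl i).trans ?_
    rw [one_pow, mul_one]
    exact hZ _ _ (by omega)
  have bA1 : |(hasseDeriv i A').eval (θ 1)| ≤ Z * P ^ 6 := by
    refine (abs_eval_hasseDeriv_le hdA' hcA' hθ1 (by linarith) i).trans ?_
    rw [mul_pow, ← mul_assoc, hPdef, ← pow_mul, mul_comm e 6, mul_assoc (4 ^ (6 * e)), ← pow_add]
    exact mul_le_mul_of_nonneg_right (hZ _ _ (by omega)) (by positivity)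
  have bS1 : |(hasseDeriv i S').eval (θ 1)| ≤ Z * P ^ 6 * L ^ s := by
    refine (abs_eval_hasseDeriv_le hdS' hcS' hθ1 (by linarith) i).trans ?_
    rw [mul_pow, ← mul_assoc, mul_assoc (4 ^ (s + 6 * e)), ← pow_add, hPdef, ← pow_mul,
      mul_comm e 6, mul_assoc, mul_assoc Z, ← pow_add, add_comm (6 * e) s, ← mul_assoc]
    exact mul_le_mul_of_nonneg_right (hZ _ _ (by omega)) (by positivity)
  have bA2 : |(hasseDeriv i A').eval (θ 2)| ≤ Z := by
    refine (abs_eval_hasseDeriv_le hdA' hcA' hθ2 le_rfl i).trans ?_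
    rw [one_pow, mul_one]
    exact hZ _ _ (by omega)
  have bS2 : |(hasseDeriv i S').eval (θ 2)| ≤ Z * (P / L ^ s) := by
    refine (abs_eval_hasseDeriv_le_of_vanish (D := 26 * e) (t := s) (by omega)
      (fun j => abs_eval_hasseDeriv_le (D := 26 * e) (x := -1) (r := 1) (by omega) hcS' (by simp)
        le_rfl j) (X_sub_C_pow_dvd_iff_hasseDeriv.mp ?_) hθ2' hLi i).trans ?_
    · refine ⟨B.map φ, ?_⟩
      rw [hS', hSdef]
      simp [add_comm]
    · have h1 : L⁻¹ ^ (s - i) ≤ P / L ^ s := by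
        rw [hPdef, le_div_iff₀ hLs, inv_pow, inv_mul_le_iff₀ (by positivity), ← pow_add]
        exact pow_le_pow_right₀ (by linarith) (by omega)
      rw [one_pow, mul_one, ← mul_assoc, ← pow_add]
      exact mul_le_mul (hZ _ _ (by omega)) h1 (by positivity) hZ0.le
  -- sizes of the three conjugates
  have hYs : L ^ s ≤ Y ^ 3 := hs1
  have b0 : |u 0 * (hasseDeriv i A').eval (θ 0) + u 1 * (hasseDeriv i S').eval (θ 0)| ≤
      2 * U * Y * Z * (P⁻¹) ^ 9 := by
    have h1 : u 0 * (hasseDeriv i A').eval (θ 0) + u 1 * (hasseDeriv i S').eval (θ 0) =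
        u 0 * (hasseDeriv i (A' - S')).eval (θ 0) - u 2 * (hasseDeriv i S').eval (θ 0) := by
      rw [map_sub, eval_sub]
      linear_combination (hasseDeriv i S').eval (θ 0) * hsum
    have h2 : U / Y ^ 2 ≤ U * Y * (P⁻¹) ^ 9 := by
      rw [inv_pow, ← div_eq_mul_inv, div_le_div_iff₀ (by positivity) (by positivity)]
      have h3 : P ^ 9 ≤ Y ^ 3 := by
        rw [hPdef, ← pow_mul]
        exact (pow_le_pow_right₀ (by linarith) (by omega)).trans hYs
      calc U * P ^ 9 ≤ U * Y ^ 3 := by gcongr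
        _ = U * Y * Y ^ 2 := by ring
    rw [h1]
    refine (abs_sub _ _).trans ?_
    rw [abs_mul, abs_mul]
    calc _ ≤ U * Y * (Z * (P⁻¹) ^ 9) + U / Y ^ 2 * Z := by gcongr
      _ ≤ U * Y * (Z * (P⁻¹) ^ 9) + U * Y * (P⁻¹) ^ 9 * Z := by gcongr
      _ = _ := by ring
  have b1 : |u 1 * (hasseDeriv i A').eval (θ 1) + u 2 * (hasseDeriv i S').eval (θ 1)| ≤
      2 * U * Y * Z * P ^ 6 := by
    refine (abs_add_le _ _).trans ?_
    rw [abs_mul, abs_mul]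
    calc _ ≤ U * Y * (Z * P ^ 6) + U / Y ^ 2 * (Z * P ^ 6 * L ^ s) := by gcongr
      _ ≤ U * Y * (Z * P ^ 6) + U / Y ^ 2 * (Z * P ^ 6 * Y ^ 3) := by gcongr
      _ = _ := by field_simp; ring
  have b2 : |u 2 * (hasseDeriv i A').eval (θ 2) + u 0 * (hasseDeriv i S').eval (θ 2)| ≤
      2 * U * Z / Y ^ 2 * (L * P) := by
    have h1 : 1 ≤ L * P := by
      have := one_le_pow₀ (n := e) (by linarith : 1 ≤ L)
      nlinarith
    have h2 : P / L ^ s ≤ L * P / Y ^ 3 := by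
      rw [div_le_div_iff₀ hLs (by positivity)]
      calc P * Y ^ 3 ≤ P * L ^ (s + 1) := by gcongr
        _ = L * P * L ^ s := by ring
    refine (abs_add_le _ _).trans ?_
    rw [abs_mul, abs_mul]
    calc _ ≤ U / Y ^ 2 * Z + U * Y * (Z * (P / L ^ s)) := by gcongr
      _ ≤ U / Y ^ 2 * Z * (L * P) + U * Y * (Z * (L * P / Y ^ 3)) := by
        exact add_le_add (le_mul_of_one_le_right (by positivity) h1) (by gcongr)
      _ = _ := by field_simp; ring
  have hfin : P ≤ 8 * U ^ 3 * L := by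
    have h1 : 1 ≤ (2 * U * Y * Z * (P⁻¹) ^ 9) * (2 * U * Y * Z * P ^ 6) *
        (2 * U * Z / Y ^ 2 * (L * P)) := by
      refine hnorm.trans ?_
      gcongr
    have h2 : (2 * U * Y * Z * (P⁻¹) ^ 9) * (2 * U * Y * Z * P ^ 6) *
        (2 * U * Z / Y ^ 2 * (L * P)) = 8 * U ^ 3 * L * Z ^ 3 / P ^ 2 := by
      field_simp
      ring
    rw [h2, le_div_iff₀ (by positivity), one_mul] at h1
    have h3 : P * P ≤ 8 * U ^ 3 * L * P := by
      rw [← sq]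
      exact h1.trans (by gcongr)
    exact le_of_mul_le_mul_right h3 hP
  have hlogP : e * Real.log L ≤ 3 * Real.log 2 + 3 * Real.log U + Real.log L := by
    have := Real.log_le_log hP hfin
    rw [Real.log_mul (by positivity) hL0.ne', Real.log_mul (by positivity) (by positivity),
      Real.log_pow, Real.log_pow, show (8 : ℝ) = 2 ^ 3 by norm_num, Real.log_pow] at this
    exact_mod_cast this
  have hse' : (s : ℝ) + 1 ≤ 10 * e + 10 := by exact_mod_cast (by omega : s + 1 ≤ 10 * e + 10)
  have := mul_le_mul_of_nonneg_right hse' (hlog2.le.trans hlogL)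
  linarith

end CyclicRoots

end LargeRoot

section CloseConjugate

lemma pow_le_abs_pow_sub_pow {x y δ : ℝ} (hδ : 0 < δ) (h : δ ≤ |(|x| - |y|)|) {a : ℕ}
    (ha : 1 ≤ a) : δ ^ a ≤ |x ^ a - y ^ a| := by
  have key : ∀ {x y : ℝ}, |y| + δ ≤ |x| → δ ^ a ≤ |x ^ a - y ^ a| := by
    intro x y h
    have h1 := pow_le_pow_left₀ (by positivity) h a
    have h2 := pow_add_pow_le (abs_nonneg y) hδ.le (by omega : a ≠ 0)
    have h3 := abs_sub_abs_le_abs_sub (x ^ a) (y ^ a)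
    rw [abs_pow, abs_pow] at h3
    linarith
  rcases le_abs.mp h with h | h
  · exact key (by linarith)
  · rw [abs_sub_comm]
    exact key (by linarith)

/-- If the product of three linear forms is small then so is one of them. -/
lemma exists_abs_sub_mul_le {α : Fin 3 → ℝ} {g m x y : ℝ} (hg : 0 < g)
    (hα : ∀ i j, i ≠ j → g ≤ |α i - α j|) (hy : y ≠ 0)
    (hm : |x - α 0 * y| * |x - α 1 * y| * |x - α 2 * y| ≤ m) :
    ∃ j, |x - α j * y| ≤ 4 * m / g ^ 2 / y ^ 2 := by
  obtain ⟨j, hj⟩ := Finite.exists_min fun j => |x - α j * y|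
  refine ⟨j, ?_⟩
  have h1 : ∀ i, i ≠ j → g * |y| / 2 ≤ |x - α i * y| := by
    intro i hi
    have h2 := abs_sub (x - α j * y) (x - α i * y)
    rw [show x - α j * y - (x - α i * y) = (α i - α j) * y by ring, abs_mul] at h2
    have h3 := mul_le_mul_of_nonneg_right (hα i j hi) (abs_nonneg y)
    linarith [hj i]
  have hpos : 0 ≤ g * |y| / 2 := by positivity
  have h2 : |x - α j * y| * (g * |y| / 2 * (g * |y| / 2)) ≤ m := by
    refine le_trans ?_ hm
    have h3 : ∀ i i' : Fin 3, i ≠ j → i' ≠ j →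
        |x - α j * y| * (g * |y| / 2 * (g * |y| / 2)) ≤
          |x - α j * y| * (|x - α i * y| * |x - α i' * y|) := fun i i' hi hi' =>
      mul_le_mul_of_nonneg_left (mul_le_mul (h1 i hi) (h1 i' hi') hpos (abs_nonneg _))
        (abs_nonneg _)
    fin_cases j
    · exact (h3 1 2 (by decide) (by decide)).trans_eq (mul_assoc _ _ _).symm
    · exact (h3 0 2 (by decide) (by decide)).trans_eq (by simp only [Fin.mk_one]; ring)
    · exact (h3 0 1 (by decide) (by decide)).trans_eq (mul_comm _ _)
  rw [div_div, le_div_iff₀ (by positivity)]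
  rw [show g * |y| / 2 * (g * |y| / 2) = g ^ 2 * y ^ 2 / 4 by rw [← sq_abs y]; ring] at h2
  linarith

lemma log_max_le {x y M K : ℝ} {α : ℝ} (hy : 1 ≤ |y|) (hM : 1 ≤ M) (hK : 1 ≤ K) (hα : |α| ≤ K)
    (h : |x - α * y| ≤ M / y ^ 2) :
    Real.log (max |x| |y|) ≤ Real.log (M + K) + Real.log |y| := by
  have h1 : M / y ^ 2 ≤ M := div_le_self (by linarith) (by rw [← sq_abs]; exact one_le_pow₀ hy)
  have h2 := abs_add_le (x - α * y) (α * y)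
  rw [sub_add_cancel, abs_mul] at h2
  have h3 : |α| * |y| ≤ K * |y| := by gcongr
  rw [← Real.log_mul (by positivity) (by positivity)]
  refine Real.log_le_log (lt_max_of_lt_right (by linarith)) (max_le ?_ ?_) <;> nlinarith

namespace CyclicRoots

variable {n : ℤ} {l : Fin 3 → ℝ}

/-- The bound for `n` large, uniform in `n`. -/
lemma log_max_le_of_large (hl : CyclicRoots n l) {k : ℕ} (hk : k = 735) (hL : 2 ^ k ≤ l 0)
    {a : ℕ} (ha : 1 ≤ a) {x y : ℤ} {m : ℝ} (hm : 1 ≤ m) (hy : y ≠ 0)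
    (h0 : ∀ r, (x : ℝ) - l r ^ a * y ≠ 0)
    (h : |x - l 0 ^ a * y| * |x - l 1 ^ a * y| * |x - l 2 ^ a * y| ≤ m) :
    Real.log (max |(x : ℝ)| |(y : ℝ)|) ≤ 100 * (Real.log m + a * Real.log (l 0)) := by
  set L := l 0 with hLdef
  have hL16 : (16 : ℝ) ≤ L := by
    refine le_trans ?_ hL
    calc (16 : ℝ) = 2 ^ 4 := by norm_num
      _ ≤ 2 ^ k := pow_le_pow_right₀ (by norm_num) (by omega)
  have hL0 : 0 < L := by linarith
  have hl1 : l 1 * (1 + L) = -1 := hl.cyc 0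
  have hl2 : l 2 * (1 + l 1) = -1 := hl.cyc 1
  have hl1e : l 1 = -(1 + L)⁻¹ := by field_simp; linarith
  have hl2e : l 2 = -(1 + L⁻¹) := by
    have h1 : (1 + l 1) ≠ 0 := fun h => by simp [h] at hl2
    apply mul_right_cancel₀ h1
    rw [hl2, hl1e]
    field_simp
    ring
  have hinv : (1 + L)⁻¹ ≤ 1 / 4 := by
    rw [inv_le_comm₀ (by positivity) (by positivity)]; linarith
  have hinv0 : 0 < (1 + L)⁻¹ := by positivity
  have hinv' : L⁻¹ ≤ 1 / 4 := by
    rw [inv_le_comm₀ (by positivity) (by positivity)]; linarith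
  have hinv0' : 0 < L⁻¹ := by positivity
  have e0 : |l 0| = L := abs_of_pos hL0
  have e1 : |l 1| = (1 + L)⁻¹ := by rw [hl1e, abs_neg, abs_of_pos hinv0]
  have e2 : |l 2| = 1 + L⁻¹ := by rw [hl2e, abs_neg, abs_of_pos (by positivity)]
  have hgap : ∀ i j, i ≠ j → (1 / 2 : ℝ) ≤ |(|l i| - |l j|)| := by
    intro i j hij
    fin_cases i <;> fin_cases j <;> first | exact absurd rfl hij | skip
    all_goals
      simp only [Fin.zero_eta, Fin.mk_one, Fin.reduceFinMk, e0, e1, e2, le_abs]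
      first | (left; linarith) | (right; linarith)
  have hK : ∀ r, |l r| ≤ L := by
    intro r
    fin_cases r <;> simp only [Fin.zero_eta, Fin.mk_one, Fin.reduceFinMk, e0, e1, e2] <;> linarith
  have hKa : ∀ r, |l r ^ a| ≤ L ^ a := fun r => by
    rw [abs_pow]; exact pow_le_pow_left₀ (abs_nonneg _) (hK r) a
  have hLa : L ≤ L ^ a := le_self_pow₀ (by linarith) (by omega)
  have h16 : (4 : ℝ) ^ a ≤ L ^ a := pow_le_pow_left₀ (by norm_num) (by linarith) a
  have hgap' : ∀ i j, i ≠ j → (1 / 2 : ℝ) ^ a ≤ |l i ^ a - l j ^ a| := fun i j hij =>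
    pow_le_abs_pow_sub_pow (by norm_num) (hgap i j hij) ha
  have hyR : (y : ℝ) ≠ 0 := by exact_mod_cast hy
  have hy1 : 1 ≤ |(y : ℝ)| := by exact_mod_cast Int.one_le_abs hy
  obtain ⟨j, hj⟩ := exists_abs_sub_mul_le (α := fun r => l r ^ a) (by positivity) hgap' hyR h
  have hMe : 4 * m / ((1 / 2 : ℝ) ^ a) ^ 2 = 4 * m * 4 ^ a := by
    rw [← pow_mul, mul_comm a 2, pow_mul, div_eq_mul_inv, ← inv_pow]
    norm_num
  rw [hMe] at hj
  set M := 4 * m * 4 ^ a with hM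
  have h4a : (1 : ℝ) ≤ 4 ^ a := one_le_pow₀ (by norm_num)
  have hM1 : 1 ≤ M := by nlinarith
  have hML : M ≤ 4 * (m * L ^ a) := by rw [hM, mul_assoc]; gcongr
  have hmL : L ^ a ≤ m * L ^ a := le_mul_of_one_le_left (by positivity) hm
  let α : Fin 3 → ℝ := fun r => l (r + j) ^ a
  have hα : α ∈ conjRing l :=
    (conjRing l).pow_mem (hl.shift_mem (root_mem_conjRing l) j) a
  let u : Fin 3 → ℝ := fun r => (x - α (r + 1) * y) * (α (r + 2) - α r)
  have hu : u ∈ conjRing l :=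
    (conjRing l).mul_mem ((conjRing l).sub_mem (intCast_mem _ x)
      ((conjRing l).mul_mem (hl.shift_mem hα 1) (intCast_mem _ y)))
      ((conjRing l).sub_mem (hl.shift_mem hα 2) hα)
  have hα2 : ∀ r r', |α r - α r'| ≤ 2 * L ^ a := fun r r' =>
    (abs_sub _ _).trans (by linarith [hKa (r + j), hKa (r' + j)])
  have hb0 : |x - α 0 * y| ≤ M / y ^ 2 := by simpa [α] using hj
  have hb : ∀ r, |x - α r * y| ≤ (M + 2 * L ^ a) * |(y : ℝ)| := by
    intro r
    have h1 := abs_add_le (x - α 0 * y) ((α 0 - α r) * y)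
    rw [show (x - α 0 * y) + ((α 0 - α r) * y) = x - α r * y by ring, abs_mul] at h1
    have h2 : M / (y : ℝ) ^ 2 ≤ M * |(y : ℝ)| :=
      (div_le_self (by linarith) (by rw [← sq_abs]; exact one_le_pow₀ hy1)).trans
        (le_mul_of_one_le_right (by linarith) hy1)
    have h3 := mul_le_mul_of_nonneg_right (hα2 0 r) (abs_nonneg (y : ℝ))
    linarith
  have hU : ∀ r, |u r| ≤ 2 * L ^ a * (M + 2 * L ^ a) * |(y : ℝ)| := by
    intro r
    rw [abs_mul, mul_comm, mul_assoc]
    exact mul_le_mul (hα2 _ _) (hb _) (abs_nonneg _) (by positivity)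
  have hU2 : |u 2| ≤ 2 * L ^ a * (M + 2 * L ^ a) / |(y : ℝ)| ^ 2 := by
    rw [abs_mul, mul_comm, sq_abs, mul_div_assoc]
    refine mul_le_mul (hα2 _ _) (hb0.trans ?_) (abs_nonneg _) (by positivity)
    gcongr
    linarith
  have hu0 : u 0 ≠ 0 := by
    refine mul_ne_zero (h0 _) fun h1 => ?_
    have h2 := hgap' (0 + 2 + j) (0 + j) (by fin_cases j <;> decide)
    rw [show l (0 + 2 + j) ^ a - l (0 + j) ^ a = 0 from h1, abs_zero] at h2
    have : (0 : ℝ) < (1 / 2) ^ a := by positivity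
    linarith
  have hmain := hl.log_le_of_large hk hL hu
    (by simp only [u, show (0 : Fin 3) + 1 = 1 from rfl, show (1 : Fin 3) + 1 = 2 from rfl,
          show (2 : Fin 3) + 1 = 0 from rfl, show (0 : Fin 3) + 2 = 2 from rfl,
          show (1 : Fin 3) + 2 = 0 from rfl, show (2 : Fin 3) + 2 = 1 from rfl]
        ring)
    hu0 hy1 (U := 2 * L ^ a * (M + 2 * L ^ a))
      (one_le_mul_of_one_le_of_one_le (by linarith) (by linarith)) (hU 0) (hU 1) hU2
  have hfin := log_max_le hy1 hM1 (by linarith : 1 ≤ L ^ a) (hKa j) hj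
  have hlogL : 0 ≤ Real.log L := Real.log_nonneg (by linarith)
  have hlog16 : Real.log 12 ≤ Real.log L := Real.log_le_log (by norm_num) (by linarith)
  have haL : Real.log L ≤ a * Real.log L :=
    le_mul_of_one_le_left hlogL (by exact_mod_cast ha)
  have hlogm : 0 ≤ Real.log m := Real.log_nonneg hm
  have b1 : Real.log (2 * L ^ a * (M + 2 * L ^ a)) ≤
      Real.log 12 + Real.log m + 2 * (a * Real.log L) := by
    have h1 : 2 * L ^ a * (M + 2 * L ^ a) ≤ 12 * m * (L ^ a) ^ 2 := by
      calc _ ≤ 2 * L ^ a * (6 * (m * L ^ a)) := by gcongr; linarith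
        _ = _ := by ring
    refine (Real.log_le_log (by positivity) h1).trans_eq ?_
    rw [Real.log_mul (by positivity) (by positivity), Real.log_mul (by positivity) (by positivity),
      Real.log_pow, Real.log_pow]
    push_cast
    ring
  have b2 : Real.log (M + L ^ a) ≤ Real.log 12 + Real.log m + a * Real.log L := by
    have h1 : M + L ^ a ≤ 12 * m * L ^ a := by
      rw [mul_assoc]
      linarith
    refine (Real.log_le_log (by positivity) h1).trans_eq ?_
    rw [Real.log_mul (by positivity) (by positivity), Real.log_mul (by positivity) (by positivity),
      Real.log_pow]
  linarith

end CyclicRoots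

end CloseConjugate

section AuxiliaryPolynomials

open Polynomial

lemma eval_hasseDeriv_eq_sum {A : ℝ[X]} {D : ℕ} (hA : A.natDegree ≤ D) (i : ℕ) (x : ℝ) :
    (hasseDeriv i A).eval x =
      ∑ j ∈ Finset.range (D + 1), (j.choose i : ℝ) * A.coeff j * x ^ (j - i) := by
  conv_lhs => rw [A.as_sum_range' (D + 1) (by omega)]
  rw [map_sum, eval_finsetSum]
  exact Finset.sum_congr rfl fun j _ => by rw [hasseDeriv_monomial, eval_monomial]

namespace CyclicRoots

variable {n : ℤ} {l : Fin 3 → ℝ}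

lemma exists_pow_coords (hl : CyclicRoots n l) {Λ : ℝ} (hΛ : |(n : ℝ)| + 3 ≤ Λ) :
    ∃ κ : ℕ → Fin 3 → ℤ, (∀ m, l 0 ^ m = κ m 0 + κ m 1 * l 0 + κ m 2 * l 0 ^ 2) ∧
      ∀ m k, |(κ m k : ℝ)| ≤ Λ ^ m := by
  suffices h : ∀ m, ∃ κ : Fin 3 → ℤ, l 0 ^ m = κ 0 + κ 1 * l 0 + κ 2 * l 0 ^ 2 ∧
      ∀ k, |(κ k : ℝ)| ≤ Λ ^ m by
    choose κ h1 h2 using h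
    exact ⟨κ, h1, h2⟩
  intro m
  induction m with
  | zero => exact ⟨![1, 0, 0], by simp, fun k => by fin_cases k <;> simp⟩
  | succ m ih =>
    obtain ⟨κ, h1, h2⟩ := ih
    have hr := hl.root 0
    unfold fn at hr
    refine ⟨![κ 2, κ 0 + (n + 2) * κ 2, κ 1 + (n - 1) * κ 2], ?_, fun k => ?_⟩
    · simp only [Matrix.cons_val]
      push_cast
      rw [pow_succ, h1]
      linear_combination (κ 2 : ℝ) * hr
    · have h3 : |(n : ℝ) + 2| ≤ |(n : ℝ)| + 2 := (abs_add_le _ _).trans (by norm_num)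
      have h4 : |(n : ℝ) - 1| ≤ |(n : ℝ)| + 1 := (abs_sub _ _).trans (by norm_num)
      have hpos := abs_nonneg (n : ℝ)
      have hΛm : 0 ≤ Λ ^ m := (abs_nonneg _).trans (h2 0)
      have key : ∀ (b : ℝ) (k k' : Fin 3), |b| ≤ |(n : ℝ)| + 2 →
          |(κ k : ℝ) + b * κ k'| ≤ Λ ^ (m + 1) := by
        intro b k k' hb
        refine (abs_add_le _ _).trans ?_
        rw [abs_mul]
        calc _ ≤ Λ ^ m + (|(n : ℝ)| + 2) * Λ ^ m := by gcongr <;> exact h2 _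
          _ ≤ _ := by rw [pow_succ]; nlinarith
      fin_cases k
      · simpa using (h2 2).trans (by rw [pow_succ]; nlinarith)
      · simpa using key _ 0 2 h3
      · simpa using key _ 1 2 (h4.trans (by linarith))

lemma pow_injective (hl : CyclicRoots n l) {a : ℕ} (ha : 1 ≤ a) :
    Function.Injective fun r => l r ^ a := by
  intro i j hij
  by_contra hne
  have h := congrArg abs hij
  simp only [abs_pow] at h
  exact hl.abs_ne hne ((pow_left_inj₀ (abs_nonneg _) (abs_nonneg _) (by omega)).mp h)

/-- Powers of the roots are irrational. -/
lemma intCast_mul_pow_ne (hl : CyclicRoots n l) {a : ℕ} (ha : 1 ≤ a) {q : ℤ} (hq : q ≠ 0) (p : ℤ)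
    (r : Fin 3) : (q : ℝ) * l r ^ a ≠ p := by
  intro h
  have hmem : (fun s => (q : ℝ) * l s ^ a - p) ∈ conjRing l :=
    (conjRing l).sub_mem ((conjRing l).mul_mem (intCast_mem _ q)
      ((conjRing l).pow_mem (root_mem_conjRing l) a)) (intCast_mem _ p)
  have h1 := hl.apply_eq_zero hmem (s := r) (sub_eq_zero.mpr h)
  have hq' : (q : ℝ) ≠ 0 := by exact_mod_cast hq
  have h2 : l 0 ^ a = l 1 ^ a := mul_left_cancel₀ hq' (by linear_combination h1 0 - h1 1)
  exact absurd (hl.pow_injective ha h2) (by decide)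

lemma exists_auxiliary_pair (hl : CyclicRoots n l) {Λ : ℝ} (hΛ : |(n : ℝ)| + 3 ≤ Λ) {e a b : ℕ}
    (he : 1 ≤ e) :
    ∃ A B : ℤ[X], A.natDegree ≤ 20 * e ∧ B.natDegree ≤ 20 * e ∧ (A ≠ 0 ∨ B ≠ 0) ∧
      (∀ j, |(A.coeff j : ℝ)| ≤ (2 ^ (26 * e) * Λ ^ (20 * e * a + b)) ^ 39) ∧
      (∀ j, |(B.coeff j : ℝ)| ≤ (2 ^ (26 * e) * Λ ^ (20 * e * a + b)) ^ 39) ∧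
      (X - C (l 0 ^ a)) ^ (13 * e) ∣
        A.map (Int.castRingHom ℝ) - C (l 0 ^ b) * B.map (Int.castRingHom ℝ) := by
  obtain ⟨κ, hκ, hκb⟩ := hl.exists_pow_coords hΛ
  have hΛ1 : 1 ≤ Λ := by linarith [abs_nonneg (n : ℝ)]
  have hΛ0 : 0 < Λ := by linarith
  have hbd : ∀ (i j m : ℕ) (k : Fin 3), j ≤ 20 * e → m ≤ 20 * e * a + b →
      |(((j.choose i : ℤ) * κ m k : ℤ) : ℝ)| ≤ 2 ^ (20 * e) * Λ ^ (20 * e * a + b) := by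
    intro i j m k hj hm
    rw [Int.cast_mul, Int.cast_natCast, abs_mul, Nat.abs_cast]
    refine mul_le_mul ?_ ((hκb m k).trans (pow_le_pow_right₀ hΛ1 hm)) (abs_nonneg _)
      (by positivity)
    calc (j.choose i : ℝ) ≤ 2 ^ j := by exact_mod_cast Nat.choose_le_two_pow _ _
      _ ≤ _ := pow_le_pow_right₀ (by norm_num) hj
  have hexp : ∀ i j, j ≤ 20 * e → a * (j - i) ≤ 20 * e * a := fun i j hj => by
    rw [mul_comm]
    exact Nat.mul_le_mul_right _ ((Nat.sub_le _ _).trans hj)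
  have hG : (1 : ℝ) ≤ 2 ^ (20 * e) * Λ ^ (20 * e * a + b) :=
    one_le_mul_of_one_le_of_one_le (one_le_pow₀ (by norm_num)) (one_le_pow₀ hΛ1)
  obtain ⟨A, B, hA, hB, hne, hcA, hcB, hlin⟩ := exists_polynomial_pair
    (ι := Fin (13 * e) × Fin 3) (20 * e) 39
    (fun i j => if j ≤ 20 * e then (j.choose i.1 : ℤ) * κ (a * (j - i.1)) i.2 else 0)
    (fun i j => if j ≤ 20 * e then -((j.choose i.1 : ℤ) * κ (a * (j - i.1) + b) i.2) else 0)
    hG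
    (fun i j => by
      split_ifs with hj
      · exact hbd _ _ _ _ hj ((hexp _ _ hj).trans (by omega))
      · simpa using by positivity)
    (fun i j => by
      split_ifs with hj
      · rw [Int.cast_neg, abs_neg]
        exact hbd _ _ _ _ hj (by have := hexp i.1 j hj; omega)
      · simpa using by positivity)
    (by simp; omega) (by simp; omega) (by simp; omega)
  have hH : ((2 * (20 * e : ℕ) + 2) * ((2 : ℝ) ^ (20 * e) * Λ ^ (20 * e * a + b))) ^ 39 ≤
      (2 ^ (26 * e) * Λ ^ (20 * e * a + b)) ^ 39 := by
    have h3 : (2 * ((20 * e : ℕ) : ℝ) + 2) ≤ 2 ^ (6 * e) := by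
      have h4 : 2 * (20 * e) + 2 ≤ 2 ^ (6 * e) := by
        clear * - he
        induction e, he using Nat.le_induction with
        | base => norm_num
        | succ e he ih => rw [show 6 * (e + 1) = 6 * e + 6 by ring, pow_add]; omega
      exact_mod_cast h4
    rw [← mul_assoc, show 26 * e = 6 * e + 20 * e by ring, pow_add 2]
    gcongr
  refine ⟨A, B, hA, hB, hne, fun j => (hcA j).trans hH, fun j => (hcB j).trans hH, ?_⟩
  rw [X_sub_C_pow_dvd_iff_hasseDeriv]
  intro i hi
  rw [map_sub, ← smul_eq_C_mul, LinearMap.map_smul, eval_sub, eval_smul, smul_eq_mul,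
    eval_hasseDeriv_eq_sum (natDegree_map_le.trans hA),
    eval_hasseDeriv_eq_sum (natDegree_map_le.trans hB), Finset.mul_sum, ← Finset.sum_sub_distrib]
  have hk : ∀ k : Fin 3, ∑ j ∈ Finset.range (20 * e + 1), (j.choose i : ℝ) *
      (A.coeff j * κ (a * (j - i)) k - B.coeff j * κ (a * (j - i) + b) k) = 0 := by
    intro k
    have h1 := congrArg (Int.cast : ℤ → ℝ) (hlin (⟨i, hi⟩, k))
    rw [Int.cast_zero, Int.cast_sum] at h1
    refine Eq.trans (Finset.sum_congr rfl fun j hj => ?_) h1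
    have hj' : j ≤ 20 * e := Nat.lt_succ_iff.mp (Finset.mem_range.mp hj)
    simp only [if_pos hj']
    push_cast
    ring
  have h3 := congrArg₂ (· + ·) (congrArg₂ (· + ·) (hk 0) (congrArg (l 0 * ·) (hk 1)))
    (congrArg (l 0 ^ 2 * ·) (hk 2))
  beta_reduce at h3
  rw [mul_zero, mul_zero, add_zero, add_zero, Finset.mul_sum, Finset.mul_sum,
    ← Finset.sum_add_distrib, ← Finset.sum_add_distrib] at h3
  refine Eq.trans (Finset.sum_congr rfl fun j _ => ?_) h3
  have e1 := hκ (a * (j - i))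
  have e2 := hκ (a * (j - i) + b)
  rw [pow_add, pow_mul] at e2
  rw [pow_mul] at e1
  simp only [coeff_map, eq_intCast]
  linear_combination (j.choose i : ℝ) * A.coeff j * e1 - (j.choose i : ℝ) * B.coeff j * e2

/-- An integer polynomial of small degree cannot vanish to high order at a power of a root. -/
lemma eq_zero_of_pow_dvd (hl : CyclicRoots n l) {a t : ℕ} (ha : 1 ≤ a) {P : ℤ[X]}
    (hP : P.natDegree < 3 * t)
    (h : (X - C (l 0 ^ a)) ^ t ∣ P.map (Int.castRingHom ℝ)) : P = 0 := by
  by_contra h0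
  obtain ⟨y, hy⟩ := Infinite.exists_notMem_finset (Finset.univ.image fun r => l r ^ a)
  have h1 := sum_order_le_natDegree (W := P.map (Int.castRingHom ℝ)) (y := y) (ν := 0)
    (by rwa [Ne, Polynomial.map_eq_zero_iff Int.cast_injective]) natDegree_map_le
    (hl.pow_injective ha) (fun r hr => hy (Finset.mem_image.mpr ⟨r, Finset.mem_univ r, hr⟩))
    (fun r => hl.X_sub_C_pow_dvd_map ((conjRing l).pow_mem (root_mem_conjRing l) a) h r)
    (by rw [pow_zero]; exact one_dvd _)
  omega

lemma wronsk_zero_ne_zero (hl : CyclicRoots n l) {D t a b : ℕ} (ha : 1 ≤ a) (hb : 1 ≤ b)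
    (hDt : D < 3 * t) {A B : ℤ[X]} (hA : A.natDegree ≤ D) (hB : B.natDegree ≤ D)
    (hne : A ≠ 0 ∨ B ≠ 0)
    (hdvd : (X - C (l 0 ^ a)) ^ t ∣
      A.map (Int.castRingHom ℝ) - C (l 0 ^ b) * B.map (Int.castRingHom ℝ)) :
    wronsk 0 A B ≠ 0 := by
  have hunit : ∀ {c : ℝ}, c ≠ 0 → IsUnit (C c) := fun hc => isUnit_C.mpr hc.isUnit
  have hA0 : A ≠ 0 := by
    rintro rfl
    refine hne.elim (fun h => h rfl) fun h => h (hl.eq_zero_of_pow_dvd ha (hB.trans_lt hDt) ?_)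
    rw [Polynomial.map_zero, zero_sub, dvd_neg] at hdvd
    exact (hunit (pow_ne_zero b (hl.ne_zero 0))).dvd_mul_left.mp hdvd
  have hB0 : B ≠ 0 := by
    rintro rfl
    refine hA0 (hl.eq_zero_of_pow_dvd ha (hA.trans_lt hDt) ?_)
    simpa using hdvd
  intro hW
  have hdeg : A.natDegree = B.natDegree := natDegree_eq_of_wronsk_eq_zero hA0 hB0 hW
  have hQ : C B.leadingCoeff * A = C A.leadingCoeff * B := by
    rw [← sub_eq_zero]
    by_contra hQ0
    have hWQ : wronsk 0 (C B.leadingCoeff * A - C A.leadingCoeff * B) B = 0 := by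
      have e : wronsk 0 (C B.leadingCoeff * A - C A.leadingCoeff * B) B
          = C B.leadingCoeff * wronsk 0 A B := by
        simp only [wronsk, derivative_sub, derivative_mul, derivative_C]
        push_cast
        ring
      rw [e, hW, mul_zero]
    have h1 := natDegree_eq_of_wronsk_eq_zero hQ0 hB0 hWQ
    apply hQ0
    rw [← leadingCoeff_eq_zero, leadingCoeff, h1, add_zero, coeff_sub, coeff_C_mul, coeff_C_mul,
      ← hdeg, coeff_natDegree, hdeg, coeff_natDegree]
    ring
  have hlB : (B.leadingCoeff : ℝ) ≠ 0 := by exact_mod_cast leadingCoeff_ne_zero.mpr hB0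
  refine hB0 (hl.eq_zero_of_pow_dvd ha (hB.trans_lt hDt) ?_)
  have hc : (A.leadingCoeff : ℝ) - B.leadingCoeff * l 0 ^ b ≠ 0 := fun h =>
    hl.intCast_mul_pow_ne hb (leadingCoeff_ne_zero.mpr hB0) A.leadingCoeff 0
      (by linear_combination -h)
  refine (hunit hc).dvd_mul_left.mp ?_
  have hQ' := congrArg (Polynomial.map (Int.castRingHom ℝ)) hQ
  rw [Polynomial.map_mul, Polynomial.map_mul, map_C, map_C, eq_intCast, eq_intCast] at hQ'
  have e : C ((A.leadingCoeff : ℝ) - B.leadingCoeff * l 0 ^ b) * B.map (Int.castRingHom ℝ) =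
      C (B.leadingCoeff : ℝ) *
        (A.map (Int.castRingHom ℝ) - C (l 0 ^ b) * B.map (Int.castRingHom ℝ)) := by
    rw [C_sub, C_mul]
    linear_combination -hQ'
  rw [e]
  exact hdvd.mul_left _

lemma exists_form_ne_zero (hl : CyclicRoots n l) {e a b : ℕ} (he : 1 ≤ e) (ha : 1 ≤ a) (hb : 1 ≤ b)
    {A B : ℤ[X]} (hA : A.natDegree ≤ 20 * e) (hB : B.natDegree ≤ 20 * e) (hne : A ≠ 0 ∨ B ≠ 0)
    (hdvd : (X - C (l 0 ^ a)) ^ (13 * e) ∣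
      A.map (Int.castRingHom ℝ) - C (l 0 ^ b) * B.map (Int.castRingHom ℝ))
    {p q p' q' : ℤ} (hq : q ≠ 0) (hq' : q' ≠ 0) :
    ∃ i ≤ e + 4, (C q' * hasseDeriv i A - C p' * hasseDeriv i B).aeval (p / q : ℝ) ≠ 0 := by
  by_contra! h
  let φ := Int.castRingHom ℝ
  have hW := hl.wronsk_zero_ne_zero ha hb (by omega) hA hB hne hdvd
  have hqR' : (q' : ℝ) ≠ 0 := by exact_mod_cast hq'
  have key : ∀ {c x : ℝ} {t : ℕ}, (X - C x) ^ (t + 1) ∣ A.map φ - C c * B.map φ →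
      (X - C x) ^ t ∣ (wronsk 0 A B).map φ := by
    intro c x t h
    rw [map_wronsk, ← wronsk_sub 0 _ _ c, pow_zero, one_mul]
    exact pow_dvd_wronsk 0 h
  have h1 : (X - C (p / q : ℝ)) ^ (e + 4 + 1) ∣ A.map φ - C (p' / q' : ℝ) * B.map φ := by
    rw [X_sub_C_pow_dvd_iff_hasseDeriv]
    intro i hi
    have h2 := h i (by omega)
    rw [map_sub, map_mul, map_mul, aeval_C, aeval_C, ← eval_hasseDeriv_map,
      ← eval_hasseDeriv_map] at h2
    change (q' : ℝ) * (hasseDeriv i (A.map φ)).eval _ - p' * (hasseDeriv i (B.map φ)).eval _ = 0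
      at h2
    rw [map_sub, ← smul_eq_C_mul, LinearMap.map_smul, eval_sub, eval_smul, smul_eq_mul]
    apply mul_left_cancel₀ hqR'
    rw [mul_sub, ← mul_assoc, mul_div_cancel₀ _ hqR', mul_zero, h2]
  have h2 : (X - C (l 0 ^ a)) ^ (13 * e - 1) ∣ (wronsk 0 A B).map φ :=
    key (c := l 0 ^ b) (by rwa [Nat.sub_add_cancel (by omega)])
  have h3 := sum_order_le_natDegree (W := (wronsk 0 A B).map φ) (D := 40 * e)
    (y := (p / q : ℝ)) (by rwa [Ne, Polynomial.map_eq_zero_iff Int.cast_injective])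
    (natDegree_map_le.trans ((natDegree_wronsk_le hA hB).trans (by omega)))
    (hl.pow_injective ha)
    (fun r hr => hl.intCast_mul_pow_ne ha hq p r (by
      rw [hr, mul_div_cancel₀ _ (by exact_mod_cast hq)]))
    (fun r => hl.X_sub_C_pow_dvd_map ((conjRing l).pow_mem (root_mem_conjRing l) a) h2 r) (key h1)
  omega

end CyclicRoots

end AuxiliaryPolynomials

section FixedRoot

open Polynomial

namespace CyclicRoots

variable {n : ℤ} {l : Fin 3 → ℝ}

set_option maxHeartbeats 1000000 in
/-- Two good rational approximations, to two powers of the same root, repel each other. -/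
lemma mul_log_le_of_two_approximations (hl : CyclicRoots n l) {Λ : ℝ} (hΛ4 : 4 ≤ Λ)
    (hΛn : |(n : ℝ)| + 3 ≤ Λ) (hΛl : |l 0| ≤ Λ) {a b e : ℕ} (ha : 1 ≤ a) (hb : 1 ≤ b) (he : 4 ≤ e)
    {h k : ℝ} (hah : a ≤ h) (hbk : b ≤ k) {p q p' q' : ℤ} (hq : 1 ≤ q)
    (h1 : |(p : ℝ) - l 0 ^ a * q| ≤ Real.exp h / (q : ℝ) ^ 2)
    (h2 : |(p' : ℝ) - l 0 ^ b * q'| ≤ Real.exp k / (q' : ℝ) ^ 2)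
    (hhq : h ≤ Real.log q) (hq1 : (q : ℝ) ^ (11 * e) ≤ q') (hq2 : (q' : ℝ) ≤ (q : ℝ) ^ (12 * e)) :
    e * Real.log q ≤ (2000 * Real.log Λ + 12) * (e * h + k) := by
  have hqR : (1 : ℝ) ≤ q := by exact_mod_cast hq
  have hq0 : (0 : ℝ) < q := by linarith
  have hq'R : (0 : ℝ) < q' := lt_of_lt_of_le (by positivity) hq1
  have hq'0 : q' ≠ 0 := by rintro rfl; simp at hq'R
  have hΛ0 : 0 < Λ := by linarith
  have hΛ1 : 1 ≤ Λ := by linarith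
  obtain ⟨A, B, hA, hB, hne, hcA, hcB, hdvd⟩ := hl.exists_auxiliary_pair hΛn (a := a) (b := b)
    (by omega : 1 ≤ e)
  obtain ⟨i, hi, hform⟩ := hl.exists_form_ne_zero (by omega) ha hb hA hB hne hdvd
    (by omega : q ≠ 0) hq'0 (p := p) (p' := p')
  set φ := Int.castRingHom ℝ
  set f := C q' * hasseDeriv i A - C p' * hasseDeriv i B with hf
  set ξ : ℝ := p / q with hξ
  set α := l 0 ^ a with hα
  set β := l 0 ^ b with hβ
  set H : ℝ := (2 ^ (26 * e) * Λ ^ (20 * e * a + b)) ^ 39 with hH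
  have hH0 : 0 < H := by positivity
  have hfdeg : f.natDegree ≤ 20 * e := by
    refine (natDegree_sub_le _ _).trans (max_le ?_ ?_)
    · exact (natDegree_C_mul_le _ _).trans ((natDegree_hasseDeriv_le A i).trans (by omega))
    · exact (natDegree_C_mul_le _ _).trans ((natDegree_hasseDeriv_le B i).trans (by omega))
  have hliou : 1 ≤ (q : ℝ) ^ (20 * e) * |aeval ξ f| := by
    have := one_le_pow_mul_abs_eval_div (K := ℝ) (f := f) (a := p) (b := q) (by omega)
      (by rwa [eval_map_algebraMap])
    rw [eval_map_algebraMap] at this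
    exact this.trans (mul_le_mul_of_nonneg_right (pow_le_pow_right₀ hqR hfdeg) (abs_nonneg _))
  set P := A.map φ - C β * B.map φ with hP
  have hdecomp : aeval ξ f = q' * (hasseDeriv i P).eval ξ -
      (p' - β * q') * (hasseDeriv i (B.map φ)).eval ξ := by
    rw [hf, hP, map_sub, map_mul, map_mul, aeval_C, aeval_C, ← eval_hasseDeriv_map,
      ← eval_hasseDeriv_map, map_sub, ← smul_eq_C_mul, LinearMap.map_smul, eval_sub, eval_smul,
      smul_eq_mul, eq_intCast, eq_intCast]
    ring
  -- the approximation
  set δ := Real.exp h / (q : ℝ) ^ 3 with hδ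
  have hδ0 : 0 < δ := by positivity
  have hexp : Real.exp h ≤ q := (Real.le_log_iff_exp_le hq0).mp hhq
  have hδ1 : δ ≤ 1 := by
    rw [hδ, div_le_one (by positivity)]
    exact hexp.trans (le_self_pow₀ hqR (by norm_num))
  have hξα : |ξ - α| ≤ δ := by
    have : ξ - α = (p - α * q) / q := by rw [hξ]; field_simp
    rw [this, abs_div, abs_of_pos hq0, hδ, div_le_iff₀ hq0]
    refine h1.trans_eq ?_
    field_simp
  have hαΛ : |α| ≤ Λ ^ a := by rw [hα, abs_pow]; exact pow_le_pow_left₀ (abs_nonneg _) hΛl a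
  have hβΛ : |β| ≤ Λ ^ b := by rw [hβ, abs_pow]; exact pow_le_pow_left₀ (abs_nonneg _) hΛl b
  have hΛa : 1 ≤ Λ ^ a := one_le_pow₀ hΛ1
  have hΛb : 1 ≤ Λ ^ b := one_le_pow₀ hΛ1
  have hξΛ : |ξ| ≤ 2 * Λ ^ a := by
    have := abs_add_le (ξ - α) α
    rw [sub_add_cancel] at this
    linarith
  -- coefficient and value bounds
  have hdB : (B.map φ).natDegree ≤ 20 * e := natDegree_map_le.trans hB
  have hdP : P.natDegree ≤ 20 * e :=
    (natDegree_sub_le _ _).trans (max_le (natDegree_map_le.trans hA)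
      ((natDegree_C_mul_le _ _).trans hdB))
  have hcB' : ∀ j, |(B.map φ).coeff j| ≤ H := fun j => by simpa [φ] using hcB j
  have hcP : ∀ j, |P.coeff j| ≤ 2 * H * Λ ^ b := fun j => by
    rw [hP, coeff_sub, coeff_C_mul]
    refine (abs_sub _ _).trans ?_
    rw [abs_mul]
    have h3 : |(A.map φ).coeff j| ≤ H * Λ ^ b := by
      refine le_trans ?_ (le_mul_of_one_le_right hH0.le hΛb)
      simpa [φ] using hcA j
    have h4 : |β| * |(B.map φ).coeff j| ≤ Λ ^ b * H :=
      mul_le_mul hβΛ (hcB' j) (abs_nonneg _) (by positivity)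
    linarith
  set F : ℝ := Λ ^ (1900 * (e * a + b)) with hF
  have hF0 : 0 < F := by positivity
  have hHF : 2 * (4 : ℝ) ^ (40 * e) * H * Λ ^ b * (Λ ^ a) ^ (20 * e) ≤ F := by
    have h24 : (2 : ℝ) ≤ Λ := by linarith
    have he' : e ≤ e * a := Nat.le_mul_of_pos_right e (by omega)
    calc _ ≤ Λ ^ 1 * Λ ^ (40 * e) * (Λ ^ (26 * e) * Λ ^ (20 * e * a + b)) ^ 39 * Λ ^ b *
          (Λ ^ a) ^ (20 * e) := by
          rw [hH, pow_one]
          gcongr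
      _ = Λ ^ (1 + 40 * e + (26 * e + (20 * e * a + b)) * 39 + b + a * (20 * e)) := by
          simp only [← pow_add, ← pow_mul]
      _ ≤ F := pow_le_pow_right₀ hΛ1 (by
          rw [show 20 * e * a = 20 * (e * a) by ring, show a * (20 * e) = 20 * (e * a) by ring]
          omega)
  have bP : |(hasseDeriv i P).eval ξ| ≤ F * δ ^ (11 * e) := by
    refine (abs_eval_hasseDeriv_le_of_vanish hdP
      (fun j => abs_eval_hasseDeriv_le hdP hcP hαΛ hΛa j)
      (X_sub_C_pow_dvd_iff_hasseDeriv.mp hdvd) hξα hδ1 i).trans ?_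
    refine mul_le_mul (le_trans (le_of_eq ?_) hHF)
      (pow_le_pow_of_le_one hδ0.le hδ1 (by omega)) (by positivity) hF0.le
    rw [show 40 * e = 20 * e + 20 * e by ring, pow_add 4]
    ring
  have bB : |(hasseDeriv i (B.map φ)).eval ξ| ≤ F := by
    refine (abs_eval_hasseDeriv_le hdB hcB' hξΛ (by linarith) i).trans ?_
    refine le_trans ?_ hHF
    have h5 : (2 : ℝ) ^ (20 * e) ≤ 4 ^ (20 * e) := pow_le_pow_left₀ (by norm_num) (by norm_num) _
    rw [mul_pow, show 40 * e = 20 * e + 20 * e by ring, pow_add 4]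
    have h6 : (1 : ℝ) ≤ 2 * Λ ^ b := by linarith
    calc _ ≤ 4 ^ (20 * e) * H * (4 ^ (20 * e) * (Λ ^ a) ^ (20 * e)) := by gcongr
      _ ≤ (2 * Λ ^ b) * (4 ^ (20 * e) * H * (4 ^ (20 * e) * (Λ ^ a) ^ (20 * e))) :=
        le_mul_of_one_le_left (by positivity) h6
      _ = _ := by ring
  have hfin : (q : ℝ) ^ e ≤ F * (2 * Real.exp (11 * e * h + k)) := by
    have h3 : |aeval ξ f| ≤ q' * (F * δ ^ (11 * e)) + Real.exp k / (q' : ℝ) ^ 2 * F := by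
      rw [hdecomp]
      refine (abs_sub _ _).trans ?_
      rw [abs_mul, abs_mul, abs_of_pos hq'R]
      gcongr
    have h4 : (q' : ℝ) * (F * δ ^ (11 * e)) ≤
        F * Real.exp (11 * e * h + k) / (q : ℝ) ^ (21 * e) := by
      have h5 : δ ^ (11 * e) = Real.exp (11 * e * h) / (q : ℝ) ^ (33 * e) := by
        rw [hδ, div_pow, ← Real.exp_nat_mul, ← pow_mul]
        push_cast
        congr 2
        ring
      have hk0 : 0 ≤ k := (Nat.cast_nonneg b).trans hbk
      have h6 : Real.exp (11 * e * h) ≤ Real.exp (11 * e * h + k) :=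
        Real.exp_le_exp.mpr (by linarith)
      rw [h5, le_div_iff₀ (by positivity)]
      calc _ ≤ (q : ℝ) ^ (12 * e) * (F * (Real.exp (11 * e * h + k) / (q : ℝ) ^ (33 * e))) *
            (q : ℝ) ^ (21 * e) := by gcongr
        _ = F * Real.exp (11 * e * h + k) *
            ((q : ℝ) ^ (12 * e) * (q : ℝ) ^ (21 * e) / (q : ℝ) ^ (33 * e)) := by ring
        _ = _ := by
          rw [← pow_add, show 12 * e + 21 * e = 33 * e by ring, div_self (by positivity), mul_one]
    have h5 : Real.exp k / (q' : ℝ) ^ 2 * F ≤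
        F * Real.exp (11 * e * h + k) / (q : ℝ) ^ (21 * e) := by
      have h0 : 0 ≤ h := (Nat.cast_nonneg a).trans hah
      have h6 : Real.exp k ≤ Real.exp (11 * e * h + k) :=
        Real.exp_le_exp.mpr (by linarith [mul_nonneg (Nat.cast_nonneg (α := ℝ) e) h0])
      have h7 : (q : ℝ) ^ (21 * e) ≤ (q' : ℝ) ^ 2 := by
        refine le_trans ?_ (pow_le_pow_left₀ (by positivity) hq1 2)
        rw [← pow_mul]
        exact pow_le_pow_right₀ hqR (by omega)
      rw [mul_comm, mul_div_assoc]
      gcongr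
    have h6 : (q : ℝ) ^ (20 * e) * |aeval ξ f| ≤
        (q : ℝ) ^ (20 * e) * (2 * (F * Real.exp (11 * e * h + k) / (q : ℝ) ^ (21 * e))) := by
      gcongr
      linarith
    have h7 := hliou.trans h6
    rw [show 21 * e = 20 * e + e by ring, pow_add] at h7
    have h8 : (q : ℝ) ^ (20 * e) * (2 * (F * Real.exp (11 * e * h + k) /
        ((q : ℝ) ^ (20 * e) * (q : ℝ) ^ e))) = F * (2 * Real.exp (11 * e * h + k)) / (q : ℝ) ^ e := by
      field_simp
    rwa [h8, le_div_iff₀ (by positivity), one_mul] at h7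
  have hlog := Real.log_le_log (by positivity) hfin
  rw [Real.log_pow, Real.log_mul hF0.ne' (by positivity), Real.log_mul (by norm_num) (by positivity),
    Real.log_exp, hF, Real.log_pow] at hlog
  push_cast at hlog
  have hlogΛ : 0 ≤ Real.log Λ := Real.log_nonneg hΛ1
  have hlog2 := Real.log_two_lt_d9
  have hb1 : (1 : ℝ) ≤ b := by exact_mod_cast hb
  have heh : (e : ℝ) * a ≤ e * h := by gcongr
  have h0 : 0 ≤ (e : ℝ) * a := by positivity
  have h9 : (1900 * ((e : ℝ) * a + b)) * Real.log Λ ≤ 2000 * Real.log Λ * (e * h + k) := by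
    have : 1900 * ((e : ℝ) * a + b) ≤ 2000 * (e * h + k) := by linarith
    have := mul_le_mul_of_nonneg_right this hlogΛ
    linarith
  linarith

/-- Powers of a fixed root are badly approximable, uniformly in the exponent. -/
lemma exists_log_denominator_le (hl : CyclicRoots n l) :
    ∃ c : ℝ, 0 ≤ c ∧ ∀ (a : ℕ) (h : ℝ) (p q : ℤ), 1 ≤ a → a ≤ h → 1 ≤ q →
      |(p : ℝ) - l 0 ^ a * q| ≤ Real.exp h / (q : ℝ) ^ 2 → Real.log q ≤ c * h := by
  by_contra! hcon
  obtain ⟨Λ, hΛ4, hΛn, hΛl⟩ : ∃ Λ : ℝ, 4 ≤ Λ ∧ |(n : ℝ)| + 3 ≤ Λ ∧ |l 0| ≤ Λ :=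
    ⟨max 4 (max (|(n : ℝ)| + 3) |l 0|), by simp, by simp, by simp⟩
  have hlogΛ : 0 ≤ Real.log Λ := Real.log_nonneg (by linarith)
  set c := 2000 * Real.log Λ + 12 with hc
  obtain ⟨a, h, p, q, ha, hah, hq, h1, hT⟩ := hcon (2 * c) (by linarith)
  obtain ⟨b, k, p', q', hb, hbk, hq', h2, hT'⟩ := hcon (24 * c + 121 * Real.log q)
    (by have := Real.log_nonneg (show (1 : ℝ) ≤ q by exact_mod_cast hq); positivity)
  have hqR : (1 : ℝ) ≤ q := by exact_mod_cast hq
  have hq'R : (1 : ℝ) ≤ q' := by exact_mod_cast hq'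
  have hh1 : 1 ≤ h := le_trans (by exact_mod_cast ha) hah
  have hk1 : 1 ≤ k := le_trans (by exact_mod_cast hb) hbk
  have hlogq : 0 < Real.log q := lt_of_le_of_lt (by positivity) hT
  have hq1 : (1 : ℝ) < q := (Real.log_pos_iff (by linarith)).mp hlogq
  obtain ⟨e, he1, he2⟩ := exists_nat_pow_near hq'R (one_lt_pow₀ hq1 (by norm_num : 11 ≠ 0))
  rw [← pow_mul] at he1 he2
  have hle : Real.log q' ≤ 11 * (e + 1) * Real.log q := by
    have := Real.log_le_log (by linarith) he2.le
    rw [Real.log_pow] at this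
    exact_mod_cast this
  have he11 : 11 ≤ e := by
    by_contra hlt
    have h3 : (e : ℝ) + 1 ≤ 11 := by exact_mod_cast (by omega : e + 1 ≤ 11)
    have h4 : 121 * Real.log q ≤ (24 * c + 121 * Real.log q) * k := by nlinarith
    nlinarith
  have heR : (11 : ℝ) ≤ e := by exact_mod_cast he11
  have hmain := hl.mul_log_le_of_two_approximations hΛ4 hΛn hΛl ha hb (by omega) hah hbk hq h1 h2
    (by nlinarith) he1 (he2.le.trans (pow_le_pow_right₀ hqR (by omega)))
  have h5 : e * (2 * c * h) < e * Real.log q := by gcongr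
  have h6 : 24 * (c * k) < 12 * (e * Real.log q) := by
    have : 0 ≤ 121 * Real.log q * k := by positivity
    nlinarith
  rw [← hc] at hmain
  linarith

end CyclicRoots

end FixedRoot

section Assembly

namespace CyclicRoots

variable {n : ℤ} {l : Fin 3 → ℝ}

/-- The bound for fixed `n`. -/
lemma exists_log_max_le (hl : CyclicRoots n l) :
    ∃ c : ℝ, 0 ≤ c ∧ ∀ (a : ℕ) (x y : ℤ) (m : ℝ), 1 ≤ a → y ≠ 0 → 1 ≤ m →
      |x - l 0 ^ a * y| * |x - l 1 ^ a * y| * |x - l 2 ^ a * y| ≤ m →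
      Real.log (max |(x : ℝ)| |(y : ℝ)|) ≤ c * (Real.log m + a) := by
  have hd : ∀ i j, i ≠ j → 0 < |(|l i| - |l j|)| := fun i j hij =>
    abs_pos.mpr (sub_ne_zero.mpr (hl.abs_ne hij))
  obtain ⟨δ, hδ0, hδ1, hδ⟩ : ∃ δ : ℝ, 0 < δ ∧ δ ≤ 1 ∧ ∀ i j, i ≠ j → δ ≤ |(|l i| - |l j|)| := by
    have : Nonempty {w : Fin 3 × Fin 3 // w.1 ≠ w.2} := ⟨⟨(0, 1), by decide⟩⟩
    obtain ⟨w, hw⟩ := Finite.exists_min fun w : {w : Fin 3 × Fin 3 // w.1 ≠ w.2} =>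
      |(|l w.1.1| - |l w.1.2|)|
    exact ⟨min 1 _, lt_min one_pos (hd _ _ w.2), min_le_left _ _, fun i j hij =>
      (min_le_right _ _).trans (hw ⟨(i, j), hij⟩)⟩
  obtain ⟨K, hK1, hK⟩ : ∃ K : ℝ, 1 ≤ K ∧ ∀ r, |l r| ≤ K := by
    obtain ⟨r, hr⟩ := Finite.exists_max fun r => |l r|
    exact ⟨max 1 |l r|, le_max_left _ _, fun s => (hr s).trans (le_max_right _ _)⟩
  choose c hc0 hc using fun j => (hl.rotate j).exists_log_denominator_le
  have hlogδ : 0 ≤ Real.log δ⁻¹ := Real.log_nonneg ((one_le_inv₀ hδ0).mpr hδ1)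
  have hlogK : 0 ≤ Real.log K := Real.log_nonneg hK1
  set κ := 2 + 2 * Real.log δ⁻¹ with hκ
  have hC0 : 0 ≤ ∑ j, c j := Finset.sum_nonneg fun j _ => hc0 j
  refine ⟨(∑ j, c j) * κ + κ + 1 + Real.log K, by positivity, fun a x y m ha hy hm h => ?_⟩
  have haR : (1 : ℝ) ≤ a := by exact_mod_cast ha
  have hlogm : 0 ≤ Real.log m := Real.log_nonneg hm
  have hm0 : 0 < m := by linarith
  have hyR : (y : ℝ) ≠ 0 := by exact_mod_cast hy
  have hy1 : 1 ≤ |(y : ℝ)| := by exact_mod_cast Int.one_le_abs hy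
  obtain ⟨j, hj⟩ := exists_abs_sub_mul_le (α := fun r => l r ^ a) (pow_pos hδ0 a)
    (fun i j hij => pow_le_abs_pow_sub_pow hδ0 (hδ i j hij) ha) hyR h
  set M := 4 * m / (δ ^ a) ^ 2 with hM
  set t := Real.log m + a * κ with ht
  have hδa : δ ^ a ≤ 1 := pow_le_one₀ hδ0.le hδ1
  have hM1 : 1 ≤ M := by
    rw [hM, le_div_iff₀ (by positivity), one_mul]
    nlinarith [pow_le_one₀ (n := 2) (pow_pos hδ0 a).le hδa]
  have hlog2 := Real.log_two_lt_d9
  have hlogM : Real.log M ≤ t := by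
    rw [hM, Real.log_div (by positivity) (by positivity), Real.log_mul (by norm_num) hm0.ne',
      Real.log_pow, Real.log_pow, show (4 : ℝ) = 2 ^ 2 by norm_num, Real.log_pow, ht, hκ,
      Real.log_inv]
    push_cast
    linarith
  have hexp : M ≤ Real.exp t := (Real.log_le_iff_le_exp (by linarith)).mp hlogM
  have hat : (a : ℝ) ≤ t := by nlinarith
  have htle : t ≤ κ * (Real.log m + a) := by nlinarith
  have hlogy : Real.log |(y : ℝ)| ≤ c j * t := by
    have hj' : |(x : ℝ) - l j ^ a * y| ≤ Real.exp t / (y : ℝ) ^ 2 := hj.trans (by gcongr)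
    rcases lt_or_gt_of_ne hy with hneg | hpos
    · have := hc j a t (-x) (-y) ha hat (by omega) (by
        push_cast
        rw [zero_add, neg_sq, show -(x : ℝ) - l j ^ a * -y = -(x - l j ^ a * y) by ring, abs_neg]
        exact hj')
      rwa [Real.log_abs, ← Real.log_neg_eq_log, ← Int.cast_neg]
    · have := hc j a t x y ha hat (by omega) (by rwa [zero_add])
      rwa [Real.log_abs]
  have hcj : c j ≤ ∑ j, c j := Finset.single_le_sum (fun j _ => hc0 j) (Finset.mem_univ j)
  have hKa : 1 ≤ K ^ a := one_le_pow₀ hK1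
  have hfin := log_max_le hy1 hM1 hKa
    (by rw [abs_pow]; exact pow_le_pow_left₀ (abs_nonneg _) (hK j) a) hj
  have hMK : Real.log (M + K ^ a) ≤ a + t + a * Real.log K := by
    have h1 : M + K ^ a ≤ 2 * M * K ^ a := by nlinarith
    refine (Real.log_le_log (by positivity) h1).trans ?_
    rw [Real.log_mul (by positivity) (by positivity), Real.log_mul (by norm_num) (by positivity),
      Real.log_pow]
    linarith
  have h2 : c j * t ≤ (∑ j, c j) * (κ * (Real.log m + a)) := by gcongr
  have h3 : 0 ≤ Real.log m * Real.log K := by positivity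
  linarith

lemma of_root {z : ℝ} (hz : fn n z = 0) :
    CyclicRoots n ![z, -(1 + z)⁻¹, -(1 + z) * z⁻¹] := by
  have h0 : z ≠ 0 := by rintro rfl; simp [fn] at hz
  have h1 : 1 + z ≠ 0 := fun h => by
    have : z = -1 := by linarith
    unfold fn at hz
    rw [this] at hz
    linarith
  have hq : z ^ 2 + z + 1 ≠ 0 := by nlinarith [sq_nonneg (z + 1 / 2)]
  unfold fn at hz
  refine ⟨fun r => ?_, fun r => ?_, fun i j hij => ?_⟩
  · fin_cases r
    · exact hz
    · simp only [Fin.mk_one, Matrix.cons_val, fn]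
      field_simp
      linear_combination -hz
    · simp only [Fin.reduceFinMk, Matrix.cons_val, fn]
      field_simp
      linear_combination hz
  · fin_cases r
    · simp only [Fin.zero_eta, zero_add, Matrix.cons_val]
      field_simp
    · simp only [Fin.mk_one, show (1 : Fin 3) + 1 = 2 from rfl, Matrix.cons_val]
      field_simp
      ring
    · simp only [Fin.reduceFinMk, show (2 : Fin 3) + 1 = 0 from rfl, Matrix.cons_val]
      field_simp
      ring
  · by_contra hne
    apply hq
    fin_cases i <;> fin_cases j <;> first | exact absurd rfl hne | skip
    all_goals
      simp only [Fin.zero_eta, Fin.mk_one, Fin.reduceFinMk, Matrix.cons_val] at hij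
      field_simp at hij
      first | linear_combination hij | linear_combination -hij

lemma prod_eq (hl : CyclicRoots n l) {l0 l1 l2 : ℝ} (h : IsRoots n l0 l1 l2) (g : ℝ → ℝ) :
    g l0 * g l1 * g l2 = g (l 0) * g (l 1) * g (l 2) := by
  obtain ⟨h0, h1, h2, h01, h02, h12⟩ := h
  obtain ⟨v1, v2, v3⟩ := hl.vieta
  have key : ∀ {z}, fn n z = 0 → z = l 0 ∨ z = l 1 ∨ z = l 2 := by
    intro z hz
    have e : (z - l 0) * ((z - l 1) * (z - l 2)) = 0 := by
      unfold fn at hz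
      linear_combination hz - z ^ 2 * v1 + z * v2 - v3
    simpa [sub_eq_zero] using e
  rcases key h0 with rfl | rfl | rfl <;> rcases key h1 with h1 | h1 | h1 <;>
    rcases key h2 with h2 | h2 | h2 <;>
    first
    | exact absurd h1.symm h01
    | exact absurd h2.symm h02
    | exact absurd (h1.trans h2.symm) h12
    | (rw [h1, h2]; done)
    | (rw [h1, h2]; ring)

end CyclicRoots

lemma exists_large_root {n : ℤ} (hn : 0 ≤ n) : ∃ z : ℝ, n ≤ z ∧ z ≤ n + 2 ∧ fn n z = 0 := by
  have hnR : (0 : ℝ) ≤ n := by exact_mod_cast hn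
  have hcont : ContinuousOn (fn n) (Set.Icc n (n + 2)) := by
    unfold fn
    fun_prop
  obtain ⟨z, hz, h0⟩ := intermediate_value_Icc (by linarith) hcont
    (show (0 : ℝ) ∈ Set.Icc (fn n n) (fn n (n + 2)) by
      constructor <;> unfold fn <;> nlinarith)
  exact ⟨z, hz.1, hz.2, h0⟩

/-- The bound for `n ≥ 0` and positive exponents. -/
lemma exists_log_max_le_of_nonneg :
    ∃ C : ℝ, 0 < C ∧ ∀ (n : ℤ) (a : ℕ) (x y : ℤ) (m l0 l1 l2 : ℝ), 0 ≤ n → 1 ≤ a → 1 ≤ m →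
      IsRoots n l0 l1 l2 → 0 < |Fna a l0 l1 l2 x y| → |Fna a l0 l1 l2 x y| ≤ m →
      Real.log (max |(x : ℝ)| |(y : ℝ)|) ≤ C * (Real.log m + a * Real.log (n + 2)) := by
  have hfix : ∀ n : ℕ, ∃ c : ℝ, 0 ≤ c ∧ ∀ (a : ℕ) (x y : ℤ) (m l0 l1 l2 : ℝ),
      1 ≤ a → y ≠ 0 → 1 ≤ m → IsRoots n l0 l1 l2 → |Fna a l0 l1 l2 x y| ≤ m →
      Real.log (max |(x : ℝ)| |(y : ℝ)|) ≤ c * (Real.log m + a) := by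
    intro n
    obtain ⟨z, -, -, hz⟩ := exists_large_root (Int.natCast_nonneg n)
    have hl := CyclicRoots.of_root hz
    obtain ⟨c, hc0, hc⟩ := hl.exists_log_max_le
    refine ⟨c, hc0, fun a x y m l0 l1 l2 ha hy hm hr h => hc a x y m ha hy hm ?_⟩
    rw [Fna, hl.prod_eq hr fun z => x - z ^ (a : ℤ) * y] at h
    simpa only [zpow_natCast, abs_mul] using h
  choose c hc0 hc using hfix
  obtain ⟨k, hk⟩ : ∃ k : ℕ, k = 735 := ⟨_, rfl⟩
  have hS : 0 ≤ ∑ i ∈ Finset.range (2 ^ k), c i := Finset.sum_nonneg fun i _ => hc0 i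
  refine ⟨100 + 2 * ∑ i ∈ Finset.range (2 ^ k), c i, by positivity,
    fun n a x y m l0 l1 l2 hn ha hm hr hpos hle => ?_⟩
  have hlogm : 0 ≤ Real.log m := Real.log_nonneg hm
  have haR : (1 : ℝ) ≤ a := by exact_mod_cast ha
  have hnR : (0 : ℝ) ≤ n := by exact_mod_cast hn
  have hlog2 := Real.log_two_gt_d9
  have hlogn : Real.log 2 ≤ Real.log (n + 2) := Real.log_le_log (by norm_num) (by linarith)
  have hpos' : 0 ≤ (a : ℝ) * Real.log (n + 2) := mul_nonneg (by linarith) (by linarith)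
  rcases eq_or_ne y 0 with rfl | hy
  · simp only [Fna, Int.cast_zero, mul_zero, sub_zero, abs_mul] at hpos hle
    have hx : x ≠ 0 := by rintro rfl; simp at hpos
    have hx1 : 1 ≤ |(x : ℝ)| := by exact_mod_cast Int.one_le_abs hx
    have hxm : |(x : ℝ)| ≤ m := by nlinarith [mul_self_nonneg |(x : ℝ)|]
    rw [Int.cast_zero, abs_zero, max_eq_left (abs_nonneg _)]
    have := Real.log_le_log (by linarith) hxm
    nlinarith
  rcases lt_or_ge n ((2 ^ k : ℕ) : ℤ) with hlt | hge
  · lift n to ℕ using hn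
    have h1 := hc n a x y m l0 l1 l2 ha hy hm hr hle
    have h2 : c n ≤ ∑ i ∈ Finset.range (2 ^ k), c i :=
      Finset.single_le_sum (fun i _ => hc0 i) (Finset.mem_range.mpr (by exact_mod_cast hlt))
    have h3 : Real.log m + a ≤ 2 * (Real.log m + a * Real.log ((n : ℤ) + 2)) := by nlinarith
    calc _ ≤ c n * (Real.log m + a) := h1
      _ ≤ (∑ i ∈ Finset.range (2 ^ k), c i) * (2 * (Real.log m + a * Real.log ((n : ℤ) + 2))) := by
        gcongr
      _ ≤ _ := by linarith
  · obtain ⟨z, hz1, hz2, hz⟩ := exists_large_root hn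
    have hl := CyclicRoots.of_root hz
    have hnz : (2 : ℝ) ^ k ≤ z := le_trans (by exact_mod_cast hge) hz1
    rw [Fna, hl.prod_eq hr fun z => x - z ^ (a : ℤ) * y] at hpos hle
    simp only [zpow_natCast] at hpos hle
    have hne := abs_pos.mp hpos
    have h1 := hl.log_max_le_of_large hk (x := x) (y := y) hnz ha hm hy (fun r => by
      have h2 := left_ne_zero_of_mul hne
      fin_cases r
      · exact left_ne_zero_of_mul h2
      · exact right_ne_zero_of_mul h2
      · exact right_ne_zero_of_mul hne) (by simpa only [abs_mul] using hle)
    have hz0 : 0 < z := lt_of_lt_of_le (by positivity) hnz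
    have h2 : Real.log z ≤ Real.log (n + 2) := Real.log_le_log hz0 hz2
    have h3 : (a : ℝ) * Real.log z ≤ a * Real.log (n + 2) := by gcongr
    have h4 : 0 ≤ (2 * ∑ i ∈ Finset.range (2 ^ k), c i) *
        (Real.log m + a * Real.log (n + 2)) := by positivity
    calc _ ≤ 100 * (Real.log m + a * Real.log z) := h1
      _ ≤ _ := by linarith

lemma IsRoots.ne_zero {n : ℤ} {l0 l1 l2 : ℝ} (h : IsRoots n l0 l1 l2) :
    l0 ≠ 0 ∧ l1 ≠ 0 ∧ l2 ≠ 0 := by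
  have key : ∀ {z}, fn n z = 0 → z ≠ 0 := by
    rintro z hz rfl
    simp [fn] at hz
  exact ⟨key h.1, key h.2.1, key h.2.2.1⟩

lemma IsRoots.inv {n : ℤ} {l0 l1 l2 : ℝ} (h : IsRoots n l0 l1 l2) :
    IsRoots (-n - 1) l0⁻¹ l1⁻¹ l2⁻¹ := by
  obtain ⟨z0, z1, z2⟩ := h.ne_zero
  obtain ⟨h0, h1, h2, h01, h02, h12⟩ := h
  have key : ∀ {z}, z ≠ 0 → fn n z = 0 → fn (-n - 1) z⁻¹ = 0 := by
    intro z hz0 hz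
    unfold fn at hz ⊢
    push_cast
    field_simp
    linear_combination -hz
  exact ⟨key z0 h0, key z1 h1, key z2 h2, inv_injective.ne h01, inv_injective.ne h02,
    inv_injective.ne h12⟩

lemma IsRoots.mul_eq_one {n : ℤ} {l0 l1 l2 : ℝ} (h : IsRoots n l0 l1 l2) : l0 * l1 * l2 = 1 := by
  have hl := CyclicRoots.of_root h.1
  rw [hl.prod_eq h fun z => z, hl.vieta.2.2]

lemma Fna_inv (a : ℤ) (l0 l1 l2 x y : ℝ) : Fna a l0⁻¹ l1⁻¹ l2⁻¹ x y = Fna (-a) l0 l1 l2 x y := by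
  simp only [Fna, inv_zpow']

lemma IsRoots.abs_Fna_neg {n : ℤ} {l0 l1 l2 : ℝ} (h : IsRoots n l0 l1 l2) (a : ℤ) (x y : ℝ) :
    |Fna (-a) l0 l1 l2 x y| = |Fna a l0 l1 l2 y x| := by
  obtain ⟨z0, z1, z2⟩ := h.ne_zero
  have h1 : l0 ^ a * l1 ^ a * l2 ^ a = 1 := by
    rw [← mul_zpow, ← mul_zpow, h.mul_eq_one, one_zpow]
  rw [← abs_neg (Fna a l0 l1 l2 y x)]
  congr 1
  have e : ∀ {z : ℝ}, z ≠ 0 → y - z ^ a * x = -(z ^ a * (x - z ^ (-a) * y)) := by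
    intro z hz
    rw [zpow_neg]
    have := zpow_ne_zero a hz
    field_simp
    ring
  rw [Fna, Fna, e z0, e z1, e z2]
  linear_combination (-(x - l0 ^ (-a) * y) * (x - l1 ^ (-a) * y) * (x - l2 ^ (-a) * y)) * h1

/-- The bound for all `n` and all nonzero exponents. -/
lemma exists_log_max_le_of_isRoots :
    ∃ C : ℝ, 0 < C ∧ ∀ (n a x y : ℤ) (m l0 l1 l2 : ℝ), a ≠ 0 → 1 ≤ m →
      IsRoots n l0 l1 l2 → 0 < |Fna a l0 l1 l2 x y| → |Fna a l0 l1 l2 x y| ≤ m →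
      Real.log (max |(x : ℝ)| |(y : ℝ)|) ≤
        C * (Real.log m + |(a : ℝ)| * Real.log (|(n : ℝ)| + 2)) := by
  obtain ⟨C, hC0, hC⟩ := exists_log_max_le_of_nonneg
  refine ⟨C, hC0, ?_⟩
  have hpos : ∀ (n a x y : ℤ) (m l0 l1 l2 : ℝ), 0 ≤ n → a ≠ 0 → 1 ≤ m →
      IsRoots n l0 l1 l2 → 0 < |Fna a l0 l1 l2 x y| → |Fna a l0 l1 l2 x y| ≤ m →
      Real.log (max |(x : ℝ)| |(y : ℝ)|) ≤
        C * (Real.log m + |(a : ℝ)| * Real.log (n + 2)) := by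
    intro n a x y m l0 l1 l2 hn ha hm hr h0 h1
    obtain ⟨b, rfl | rfl⟩ := a.eq_nat_or_neg
    · simpa using hC n b x y m l0 l1 l2 hn (by omega) hm hr h0 h1
    · rw [hr.abs_Fna_neg] at h0 h1
      rw [max_comm]
      simpa using hC n b y x m l0 l1 l2 hn (by omega) hm hr h0 h1
  intro n a x y m l0 l1 l2 ha hm hr h0 h1
  rcases le_or_gt 0 n with hn | hn
  · rw [abs_of_nonneg (a := (n : ℝ)) (by exact_mod_cast hn)]
    exact hpos n a x y m l0 l1 l2 hn ha hm hr h0 h1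
  · have hnR : (n : ℝ) ≤ -1 := by exact_mod_cast (by omega : n ≤ -1)
    rw [← neg_neg a, ← Fna_inv] at h0 h1
    have h2 := hpos (-n - 1) (-a) x y m _ _ _ (by omega) (by omega) hm hr.inv h0 h1
    refine h2.trans ?_
    push_cast
    rw [abs_neg, abs_of_neg (a := (n : ℝ)) (by linarith)]
    have h3 : Real.log (-n - 1 + 2) ≤ Real.log (-n + 2) :=
      Real.log_le_log (by linarith) (by linarith)
    gcongr

end Assembly

theorem stmt1 :
    ∃ C : ℝ, 0 < C ∧ ∀ (n a m x y : ℤ) (l0 l1 l2 : ℝ), IsRoots n l0 l1 l2 →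
      a ≠ 0 → 1 ≤ m →
      0 < |Fna a l0 l1 l2 (x : ℝ) (y : ℝ)| →
      |Fna a l0 l1 l2 (x : ℝ) (y : ℝ)| ≤ (m : ℝ) →
      Real.log (max |(x : ℝ)| |(y : ℝ)|) ≤
        C * (if 3 ≤ |n| then
              (Real.log (m : ℝ) + |(a : ℝ)| * Real.log |(n : ℝ)|) *
                (Real.log |(n : ℝ)|) ^ 2 * Real.log (Real.log |(n : ℝ)|)
             else Real.log (m : ℝ) + |(a : ℝ)|) := by
  obtain ⟨C, hC0, hC⟩ := exists_log_max_le_of_isRoots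
  have hlog3 : 1 < Real.log 3 := by
    rw [Real.lt_log_iff_exp_lt (by norm_num)]
    linarith [Real.exp_one_lt_d9]
  set κ := Real.log (Real.log 3) with hκ
  have hκ0 : 0 < κ := Real.log_pos hlog3
  refine ⟨2 * C + 2 * C / κ, by positivity, fun n a m x y l0 l1 l2 hr ha hm h0 h1 => ?_⟩
  have hmR : (1 : ℝ) ≤ m := by exact_mod_cast hm
  have hlogm : 0 ≤ Real.log m := Real.log_nonneg hmR
  refine (hC n a x y m l0 l1 l2 ha hmR hr h0 h1).trans ?_
  split_ifs with hn
  · have hnR : (3 : ℝ) ≤ |(n : ℝ)| := by exact_mod_cast hn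
    set L := Real.log |(n : ℝ)| with hL
    have hL3 : Real.log 3 ≤ L := Real.log_le_log (by norm_num) hnR
    have hLL : κ ≤ Real.log L := Real.log_le_log (by linarith) hL3
    have h2 : Real.log (|(n : ℝ)| + 2) ≤ 2 * L := by
      rw [hL, ← Nat.cast_two (R := ℝ), ← Real.log_pow]
      exact Real.log_le_log (by positivity) (by push_cast; nlinarith)
    have hL2 : 1 ≤ L ^ 2 := one_le_pow₀ (by linarith)
    have hT : 0 ≤ Real.log m + |(a : ℝ)| * L := by
      have : 0 ≤ L := by linarith
      positivity
    have hTL : (Real.log m + |(a : ℝ)| * L) * κ ≤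
        (Real.log m + |(a : ℝ)| * L) * L ^ 2 * Real.log L := by
      rw [mul_assoc]
      refine mul_le_mul_of_nonneg_left ?_ hT
      nlinarith
    calc _ ≤ C * (Real.log m + |(a : ℝ)| * (2 * L)) := by gcongr
      _ ≤ 2 * C / κ * ((Real.log m + |(a : ℝ)| * L) * κ) := by
        field_simp
        linarith
      _ ≤ 2 * C / κ * ((Real.log m + |(a : ℝ)| * L) * L ^ 2 * Real.log L) := by gcongr
      _ ≤ _ := mul_le_mul_of_nonneg_right (by linarith) ((mul_nonneg hT hκ0.le).trans hTL)
  · have hnR : |(n : ℝ)| ≤ 2 := by exact_mod_cast (by omega : |n| ≤ 2)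
    have h2 : Real.log (|(n : ℝ)| + 2) ≤ 2 := by
      calc _ ≤ Real.log (2 ^ 2) := Real.log_le_log (by positivity) (by linarith)
        _ ≤ 2 := by
          rw [Real.log_pow]
          push_cast
          linarith [Real.log_two_lt_d9]
    have h3 : |(a : ℝ)| * Real.log (|(n : ℝ)| + 2) ≤ |(a : ℝ)| * 2 := by gcongr
    calc _ ≤ C * (2 * (Real.log m + |(a : ℝ)|)) := by gcongr; linarith
      _ ≤ _ := by
        rw [add_mul]
        have : 0 ≤ 2 * C / κ * (Real.log m + |(a : ℝ)|) := by positivity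
        linarith
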